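/- arXiv:math/0411457 — 2 statements merged into one kernel-verified Lean document; each statement's English description precedes it below -/
import Mathlib

section
/- Exact weighted Euler–Maclaurin for polynomials on an interval: Let q ∈ ℂ, let a < b be integers, let p : ℝ → ℂ be a polynomial, and let k be a positive integer with 2k > deg p. Then Σ^q_{[a,b]} p = χ_q^{2k}(∂/∂h₁) χ_q^{2k}(∂/∂h₂) F(h₁,h₂) |_{h₁=h₂=0}, where F(h₁,h₂) = ∫_{a−h₁}^{b+h₂} p(x) dx. -/
open scoped BigOperators Classical
open MeasureTheory

/-- Coefficients of the Todd power series `Td(S) = S/(1-e^{-S}) = ∑ bernoulli' n · Sⁿ/n!`. -/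
noncomputable def toddCoeff (j : ℕ) : ℂ := (bernoulli' j : ℂ) / j.factorial

/-- Coefficients of the Hirzebruch power series `χ_q(S) = q·Td(S) + (1-q)·Td(-S)`. -/
noncomputable def chiCoeff (q : ℂ) (j : ℕ) : ℂ :=
  q * toddCoeff j + (1 - q) * (-1) ^ j * toddCoeff j

/-- Every complex polynomial has a polynomial antiderivative of degree at most one more. -/
theorem exists_derivative_eq_natDegree_le (p : Polynomial ℂ) :
    ∃ P : Polynomial ℂ, P.derivative = p ∧ P.natDegree ≤ p.natDegree + 1 := by
  refine ⟨∑ i ∈ Finset.range (p.natDegree + 1),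
    Polynomial.monomial (i + 1) (p.coeff i / (i + 1)), ?_, ?_⟩
  · conv_rhs => rw [p.as_sum_range]
    rw [Polynomial.derivative_sum]
    refine Finset.sum_congr rfl fun i _ => ?_
    have hi : (i : ℂ) + 1 ≠ 0 := Nat.cast_add_one_ne_zero i
    rw [Polynomial.derivative_monomial, Nat.add_sub_cancel, Nat.cast_add_one, div_mul_cancel₀ _ hi]
  · refine Polynomial.natDegree_sum_le_of_forall_le _ _ fun i hi => ?_
    have := Finset.mem_range.mp hi
    exact (Polynomial.natDegree_monomial_le _).trans (by lia)

/-- The differential operator `∑_{j < N} Bⱼ/j! · ∂ʲ` sends `Xⁿ` to the Bernoulli polynomial `Bₙ`. -/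
theorem sum_bernoulli_smul_iterate_derivative_X_pow {n N : ℕ} (h : n < N) :
    ∑ j ∈ Finset.range N, ((bernoulli j : ℂ) / j.factorial) •
      Polynomial.derivative^[j] (Polynomial.X ^ n : Polynomial ℂ) =
    (Polynomial.bernoulli n).map (algebraMap ℚ ℂ) := by
  rw [Polynomial.bernoulli, Polynomial.map_sum]
  symm
  refine Finset.sum_subset_zero_on_sdiff (Finset.range_mono h) (fun j hj => ?_) fun j hj => ?_
  · have hn : n < j := by
      simp only [Finset.mem_sdiff, Finset.mem_range] at hj
      lia
    simp [Polynomial.iterate_derivative_X_pow_eq_smul, Nat.descFactorial_eq_zero_iff_lt.mpr hn]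
  · have hf : (j.factorial : ℂ) ≠ 0 := by exact_mod_cast j.factorial_ne_zero
    rw [Polynomial.iterate_derivative_X_pow_eq_smul, smul_smul, Polynomial.map_monomial,
      Nat.descFactorial_eq_factorial_mul_choose, ← Polynomial.C_mul_X_pow_eq_monomial,
      Polynomial.smul_eq_C_mul]
    congr 2
    push_cast
    simp only [eq_ratCast]
    field_simp

/-- On polynomials of degree less than `N`, the operator `∑_{j < N} Bⱼ/j! · ∂ʲ` inverts the
forward difference operator up to differentiation. -/
theorem sum_bernoulli_mul_iterate_derivative_eval_add_one {N : ℕ} (P : Polynomial ℂ)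
    (hP : P.natDegree < N) (x : ℂ) :
    ∑ j ∈ Finset.range N,
        (bernoulli j : ℂ) / j.factorial * (Polynomial.derivative^[j] P).eval (x + 1) =
      ∑ j ∈ Finset.range N,
        (bernoulli j : ℂ) / j.factorial * (Polynomial.derivative^[j] P).eval x +
        P.derivative.eval x := by
  let T : Polynomial ℂ →ₗ[ℂ] Polynomial ℂ :=
    ∑ j ∈ Finset.range N, ((bernoulli j : ℂ) / j.factorial) • Polynomial.derivative ^ j
  have hT (Q : Polynomial ℂ) (y : ℂ) : (T Q).eval y = ∑ j ∈ Finset.range N,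
      (bernoulli j : ℂ) / j.factorial * (Polynomial.derivative^[j] Q).eval y := by
    simp [T, Polynomial.eval_finsetSum, Module.End.pow_apply]
  rw [← hT, ← hT]
  have key (n : ℕ) (hn : n < N) : (T (Polynomial.X ^ n)).eval (x + 1) =
      (T (Polynomial.X ^ n)).eval x + (Polynomial.X ^ n : Polynomial ℂ).derivative.eval x := by
    have e : T (Polynomial.X ^ n) = (Polynomial.bernoulli n).map (algebraMap ℚ ℂ) := by
      rw [← sum_bernoulli_smul_iterate_derivative_X_pow hn]
      simp [T, Module.End.pow_apply]
    have h := congr((($(Polynomial.bernoulli_comp_one_add_X n)).map (algebraMap ℚ ℂ)).eval x)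
    rw [e]
    simpa [Polynomial.map_comp, Polynomial.derivative_X_pow, add_comm] using h
  rw [P.as_sum_range_C_mul_X_pow]
  simp only [map_sum, Polynomial.eval_finsetSum, ← Finset.sum_add_distrib]
  refine Finset.sum_congr rfl fun i hi => ?_
  have := Finset.mem_range.mp hi
  simp only [← Polynomial.smul_eq_C_mul, map_smul, Polynomial.eval_smul, smul_eq_mul,
    key i (by lia), mul_add]

/-- A discrete antiderivative on `ℤ` computes sums over half-open intervals. -/
theorem sum_Ico_int_of_eq_add {f g : ℤ → ℂ} (h : ∀ n, g (n + 1) = g n + f n) {a b : ℤ}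
    (hab : a ≤ b) : ∑ j ∈ Finset.Ico a b, f j = g b - g a := by
  induction b, hab using Int.leInduction with
  | base => simp
  | succ n hn ih =>
    have e : Finset.Ico a (n + 1) = insert n (Finset.Ico a n) := by
      ext j
      simp only [Finset.mem_Ico, Finset.mem_insert]
      lia
    rw [e, Finset.sum_insert (by simp), ih, h]
    ring

theorem iteratedDeriv_const_add_mul_eval (P : Polynomial ℂ) (d e c s : ℂ) (j : ℕ) :
    iteratedDeriv j (fun h : ℝ => d + e * P.eval (c + s * h)) =
      fun h : ℝ => (if j = 0 then d else 0) +
        e * s ^ j * (Polynomial.derivative^[j] P).eval (c + s * h) := by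
  induction j with
  | zero => simp
  | succ j ih =>
    rw [iteratedDeriv_succ, ih]
    funext h
    have h1 : HasDerivAt (fun h : ℝ => c + s * (h : ℂ)) s h := by
      simpa using ((Complex.ofRealCLM.hasDerivAt (x := h)).const_mul s).const_add c
    have h2 := (((Polynomial.derivative^[j] P).hasDerivAt (c + s * h)).comp h h1).const_mul
      (e * s ^ j) |>.const_add (if j = 0 then d else 0)
    refine h2.deriv.trans ?_
    simp only [Function.iterate_succ_apply', Nat.add_eq_zero_iff, one_ne_zero, and_false, if_false]
    ring

theorem integral_eval_derivative (P : Polynomial ℂ) (u v : ℝ) :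
    ∫ x in u..v, P.derivative.eval (x : ℂ) = P.eval (v : ℂ) - P.eval (u : ℂ) := by
  refine intervalIntegral.integral_eq_sub_of_hasDerivAt
    (f := fun x : ℝ => P.eval (x : ℂ)) (fun x _ => (P.hasDerivAt (x : ℂ)).comp_ofReal) ?_
  exact (P.derivative.continuous.comp Complex.continuous_ofReal).intervalIntegrable _ _

theorem chiCoeff_eq (q : ℂ) (j : ℕ) :
    chiCoeff q j = (bernoulli j : ℂ) / j.factorial + if j = 1 then q else 0 := by
  rcases eq_or_ne j 1 with rfl | hj
  · simp [chiCoeff, toddCoeff]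
    ring
  · have h := bernoulli'_eq_bernoulli j
    have h' : (-1) ^ j * (bernoulli j : ℂ) = bernoulli j := by
      rw [bernoulli_eq_bernoulli'_of_ne_one hj] at h ⊢
      exact_mod_cast h.symm
    rw [chiCoeff, toddCoeff, ← bernoulli_eq_bernoulli'_of_ne_one hj, if_neg hj]
    linear_combination (1 - q) / j.factorial * h'

theorem chiCoeff_mul_neg_one_pow (q : ℂ) (j : ℕ) :
    chiCoeff q j * (-1) ^ j = chiCoeff (1 - q) j := by
  have h : ((-1 : ℂ) ^ j) * (-1) ^ j = 1 := by rw [← mul_pow]; simp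
  simp only [chiCoeff]
  linear_combination (1 - q) * toddCoeff j * h

theorem chiCoeff_zero (q : ℂ) : chiCoeff q 0 = 1 := by
  simp [chiCoeff_eq]

theorem sum_chiCoeff_mul_iterate_derivative_eval (q x : ℂ) (P : Polynomial ℂ) {N : ℕ}
    (hN : 1 < N) :
    ∑ j ∈ Finset.range N, chiCoeff q j * (Polynomial.derivative^[j] P).eval x =
      ∑ j ∈ Finset.range N,
        (bernoulli j : ℂ) / j.factorial * (Polynomial.derivative^[j] P).eval x +
        q * P.derivative.eval x := by
  simp [chiCoeff_eq, add_mul, Finset.sum_add_distrib, ite_mul, hN]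

/-- **Exact weighted Euler–Maclaurin for polynomials on an interval.**
For `q ∈ ℂ`, integers `a < b`, a polynomial `p` and a positive integer `k` with `2k > deg p`,
`Σ^q_{[a,b]} p = χ_q^{2k}(∂/∂h₁) χ_q^{2k}(∂/∂h₂) ∫_{a-h₁}^{b+h₂} p |_{h₁=h₂=0}`. -/
theorem exact_weighted_euler_maclaurin_interval_poly
    (q : ℂ) (a b : ℤ) (hab : a < b) (p : Polynomial ℂ) (k : ℕ) (hk : 0 < k)
    (hdeg : p.natDegree < 2 * k) :
    q * p.eval (a : ℂ) + (∑ j ∈ Finset.Ioo a b, p.eval (j : ℂ)) + q * p.eval (b : ℂ) =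
      ∑ j₁ ∈ Finset.range (2 * k + 1), ∑ j₂ ∈ Finset.range (2 * k + 1),
        chiCoeff q j₁ * chiCoeff q j₂ *
          iteratedDeriv j₁ (fun h₁ : ℝ =>
            iteratedDeriv j₂ (fun h₂ : ℝ =>
              ∫ x in ((a : ℝ) - h₁)..((b : ℝ) + h₂), p.eval (x : ℂ)) 0) 0 := by
  obtain ⟨P, rfl, hP⟩ := exists_derivative_eq_natDegree_le p
  have hD (j₁ j₂ : ℕ) : iteratedDeriv j₁ (fun h₁ : ℝ => iteratedDeriv j₂ (fun h₂ : ℝ =>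
      ∫ x in ((a : ℝ) - h₁)..((b : ℝ) + h₂), P.derivative.eval (x : ℂ)) 0) 0 =
      (if j₁ = 0 then (Polynomial.derivative^[j₂] P).eval (b : ℂ) else 0) -
      (if j₂ = 0 then (-1) ^ j₁ * (Polynomial.derivative^[j₁] P).eval (a : ℂ) else 0) := by
    have inner (h₁ : ℝ) : iteratedDeriv j₂ (fun h₂ : ℝ =>
        ∫ x in ((a : ℝ) - h₁)..((b : ℝ) + h₂), P.derivative.eval (x : ℂ)) 0 =
        (Polynomial.derivative^[j₂] P).eval (b : ℂ) +
          (if j₂ = 0 then -1 else 0) * P.eval ((a : ℂ) + -1 * h₁) := by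
      have e := congrFun (iteratedDeriv_const_add_mul_eval P
        (-P.eval ((a : ℂ) + -1 * h₁)) 1 b 1 j₂) 0
      convert e using 1
      · congr 1
        funext h₂
        rw [integral_eval_derivative]
        push_cast
        ring_nf
      · simp only [Complex.ofReal_zero, mul_zero, add_zero, one_pow, one_mul]
        split_ifs <;> ring
    simp only [inner, iteratedDeriv_const_add_mul_eval]
    simp only [Complex.ofReal_zero, mul_zero, add_zero]
    split_ifs <;> ring
  have hsum : ∑ j₁ ∈ Finset.range (2 * k + 1), ∑ j₂ ∈ Finset.range (2 * k + 1),
      chiCoeff q j₁ * chiCoeff q j₂ *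
        ((if j₁ = 0 then (Polynomial.derivative^[j₂] P).eval (b : ℂ) else 0) -
        (if j₂ = 0 then (-1) ^ j₁ * (Polynomial.derivative^[j₁] P).eval (a : ℂ) else 0)) =
      ∑ j ∈ Finset.range (2 * k + 1),
        chiCoeff q j * (Polynomial.derivative^[j] P).eval (b : ℂ) -
      ∑ j ∈ Finset.range (2 * k + 1),
        chiCoeff (1 - q) j * (Polynomial.derivative^[j] P).eval (a : ℂ) := by
    simp only [mul_sub, Finset.sum_sub_distrib]
    congr 1
    · rw [Finset.sum_comm]
      simp [chiCoeff_zero]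
    · simp [chiCoeff_zero, ← chiCoeff_mul_neg_one_pow, mul_assoc]
  have hIco := sum_Ico_int_of_eq_add (f := fun n : ℤ => P.derivative.eval (n : ℂ))
    (g := fun n : ℤ => ∑ j ∈ Finset.range (2 * k + 1),
      (bernoulli j : ℂ) / j.factorial * (Polynomial.derivative^[j] P).eval (n : ℂ))
    (fun n => by
      simpa using sum_bernoulli_mul_iterate_derivative_eval_add_one (N := 2 * k + 1) P
        (by lia) (n : ℂ)) hab.le
  rw [← Finset.Ioo_insert_left hab, Finset.sum_insert (by simp)] at hIco
  simp only [hD]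
  rw [hsum, sum_chiCoeff_mul_iterate_derivative_eval _ _ _ (by lia),
    sum_chiCoeff_mul_iterate_derivative_eval _ _ _ (by lia)]
  linear_combination hIco
end

section
/- Twisted weighted Euler–Maclaurin with remainder for the standard orthant: Let n ≥ 1, let λ_1,…,λ_n be roots of unity (possibly equal to 1), let q_1,…,q_n ∈ ℂ, let k > 1 be an integer, and let g : ℝ^n → ℂ be a compactly supported function of class C^{nk}. Then Σ_{m ∈ ℤ_{≥0}^n} (Π_{i : m_i = 0} q_i)(Π_{i=1}^n λ_i^{m_i}) g(m) = [Π_{i=1}^n N_{q_i}^{k,λ_i}(∂/∂h_i)] H(h) |_{h=0} + R^{st}_{q,k}(λ_1,…,λ_n; g), where H(h) = ∫_{O(h)} g(t) dt with O(h) = {t ∈ ℝ^n : t_i ≥ −h_i for all i}, and R^{st}_{q,k}(λ_1,…,λ_n; g) := Σ_{I ⊊ {1,…,n}} (−1)^{(k−1)(n−|I|)} [Π_{i ∈ I} N_{q_i}^{k,λ_i}(∂/∂h_i)] ( ∫_{O(h)} Π_{i ∉ I} Q_{k,λ_i}(t_i) · (Π_{i ∉ I} ∂^k/∂t_i^k)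 g(t) dt ) |_{h=0}, the sum running over all proper subsets I of {1,…,n}. -/
open scoped BigOperators Classical
open MeasureTheory

/-- `P_m(x) = B_m({x})/m!`. -/
noncomputable def periodicBernoulli (m : ℕ) (x : ℝ) : ℂ :=
  Polynomial.aeval ((Int.fract x : ℝ) : ℂ) (Polynomial.bernoulli m) / m.factorial

/-- The family `Q_{·,λ}`:  for `λ = 1` it is `Q_{m,1} = P_m = B_m({x})/m!`; for a root of
unity `λ ≠ 1` of order `N = orderOf λ`, `Q_{1,λ}(x) = λ^{⌊x⌋+1}/(1-λ)` and, for `m ≥ 2`,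
`Q_{m,λ}` is the unique continuous function with `Q_{m,λ}(x) = Q_{m,λ}(0) + ∫₀ˣ Q_{m-1,λ}`
and `∫₀ᴺ Q_{m,λ} = 0`. -/
def IsQFamily (lam : ℂ) (Q : ℕ → ℝ → ℂ) : Prop :=
  if lam = 1 then ∀ m x, Q m x = periodicBernoulli m x
  else (∀ x : ℝ, Q 1 x = lam ^ (⌊x⌋ + 1) / (1 - lam)) ∧
    ∀ m, 2 ≤ m → Continuous (Q m) ∧
      (∀ x : ℝ, Q m x = Q m 0 + ∫ t in (0 : ℝ)..x, Q (m - 1) t) ∧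
      (∫ t in (0 : ℝ)..((orderOf lam : ℕ) : ℝ), Q m t) = 0

/-- Coefficients of the polynomial `N_q^{k,λ}`:  for `λ ≠ 1`,
`N_q^{k,λ}(S) = (q + λ/(1-λ))S + ∑_{j=2}^k Q_{j,λ}(0)Sʲ`; for `λ = 1`,
`N_q^{k,1}(S) = χ_q^{2⌊k/2⌋}(S)`. -/
noncomputable def Ncoeff (q lam : ℂ) (Q : ℕ → ℝ → ℂ) (k : ℕ) : ℕ → ℂ := fun j =>
  if lam = 1 then (if j ≤ 2 * (k / 2) then chiCoeff q j else 0)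
  else (if j = 1 then q + lam / (1 - lam) else if 2 ≤ j ∧ j ≤ k then Q j 0 else 0)

/-- The partial derivative in the `i`-th coordinate direction. -/
noncomputable def coordPartial {n : ℕ} (i : Fin n)
    (H : (Fin n → ℝ) → ℂ) : (Fin n → ℝ) → ℂ :=
  fun x => fderiv ℝ H x (Pi.single i 1)

/-- The mixed partial derivative `∂^{j₁}_{h₁} ⋯ ∂^{jₙ}_{hₙ} H`. -/
noncomputable def mixedPartial {n : ℕ} (j : Fin n → ℕ)
    (H : (Fin n → ℝ) → ℂ) : (Fin n → ℝ) → ℂ :=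
  (List.finRange n).foldr (fun i G => (coordPartial i)^[j i] G) H

/-- `[∏ i, pᵢ(∂/∂hᵢ)] H |_{h=0}`, where `pᵢ` has coefficients `c i` and all the `pᵢ`
have degree `≤ k`. -/
noncomputable def opApply {n : ℕ} (c : Fin n → ℕ → ℂ) (k : ℕ)
    (H : (Fin n → ℝ) → ℂ) : ℂ :=
  ∑ j ∈ Fintype.piFinset (fun _ : Fin n => Finset.range (k + 1)),
    (∏ i, c i (j i)) * mixedPartial j H 0

/-- The dilated standard orthant `O(h) = {t : tᵢ ≥ -hᵢ for all i}`. -/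
def stdOrthant (n : ℕ) (h : Fin n → ℝ) : Set (Fin n → ℝ) := {t | ∀ i, -h i ≤ t i}

/-- The remainder `R^{st}_{q,k}(λ₁,…,λₙ; g)` for the standard orthant. -/
noncomputable def orthantRemainder {n : ℕ} (q lam : Fin n → ℂ)
    (Q : Fin n → ℕ → ℝ → ℂ) (k : ℕ) (g : (Fin n → ℝ) → ℂ) : ℂ :=
  ∑ I ∈ Finset.univ.powerset.erase (Finset.univ : Finset (Fin n)),
    (-1 : ℂ) ^ ((k - 1) * (n - I.card)) *
      opApply
        (fun i => if i ∈ I then Ncoeff (q i) (lam i) (Q i) k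
          else fun j => if j = 0 then 1 else 0) k
        (fun h => ∫ t in stdOrthant n h,
          (∏ i ∈ Iᶜ, Q i k (t i)) *
            mixedPartial (fun i => if i ∈ I then 0 else k) g t)

/-! ### One-dimensional summation formula -/

/-- The properties of the family `Q` that drive the one-dimensional summation formula:
`Q 1` is a sawtooth with slope `c` whose jump at the positive integer `m` is `-lam ^ m`,
and the higher members are continuous successive antiderivatives. -/
structure IsSawtoothFamily (lam c a : ℂ) (Q : ℕ → ℝ → ℂ) : Prop where
  continuous : ∀ m, 2 ≤ m → Continuous (Q m)
  hasDeriv_right : ∀ m, 2 ≤ m → ∀ x, HasDerivWithinAt (Q m) (Q (m - 1) x) (Set.Ioi x) x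
  one_eq : ∀ x : ℝ, Q 1 x = c * (Int.fract x : ℝ) + a * lam ^ ⌊x⌋
  jump : ∀ m : ℕ, a * lam ^ (m + 1) = c + a * lam ^ m - lam ^ (m + 1)

namespace IsSawtoothFamily

variable {lam c a : ℂ} {Q : ℕ → ℝ → ℂ}

theorem one_eq_of_mem (P : IsSawtoothFamily lam c a Q) (m : ℕ) {x : ℝ}
    (hx : x ∈ Set.Ioo (m : ℝ) (m + 1)) : Q 1 x = c * (x - m) + a * lam ^ m := by
  have hfl : ⌊x⌋ = (m : ℤ) := by
    rw [Int.floor_eq_iff]; exact ⟨by simpa using hx.1.le, by simpa using hx.2⟩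
  rw [P.one_eq, Int.fract, hfl]
  push_cast
  rw [zpow_natCast]

theorem intervalIntegrable_one (P : IsSawtoothFamily lam c a Q) (M : ℕ) :
    IntervalIntegrable (Q 1) volume 0 M := by
  have h : ∀ m < M, IntervalIntegrable (Q 1) volume ((fun m : ℕ => (m : ℝ)) m)
      ((fun m : ℕ => (m : ℝ)) (m + 1)) := by
    intro m _
    have hc : Continuous fun x : ℝ => c * ((x : ℂ) - m) + a * lam ^ m := by fun_prop
    refine (hc.intervalIntegrable (m : ℝ) ((m + 1 : ℕ) : ℝ)).congr_uIoo ?_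
    intro x hx
    rw [Set.uIoo_of_le (by push_cast; linarith)] at hx
    push_cast at hx
    exact (P.one_eq_of_mem m hx).symm
  simpa using IntervalIntegrable.trans_iterate h

theorem intervalIntegrable (P : IsSawtoothFamily lam c a Q) {j : ℕ} (hj : 1 ≤ j) (M : ℕ) :
    IntervalIntegrable (Q j) volume 0 M := by
  rcases hj.eq_or_lt with rfl | h
  · exact P.intervalIntegrable_one M
  · exact (P.continuous j h).intervalIntegrable _ _

theorem integral_unit (P : IsSawtoothFamily lam c a Q) {f f' : ℝ → ℂ}
    (hf : ∀ x, HasDerivAt f (f' x) x) (hf' : Continuous f') (m : ℕ) :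
    ∫ x in (m : ℝ)..(m + 1 : ℕ), Q 1 x * f' x =
      (c + a * lam ^ m) * f (m + 1) - a * lam ^ m * f m
        - c * ∫ x in (m : ℝ)..(m + 1 : ℕ), f x := by
  have h1 : ∫ x in (m : ℝ)..(m + 1 : ℕ), Q 1 x * f' x =
      ∫ x in (m : ℝ)..(m + 1 : ℕ), (c * ((x : ℂ) - m) + a * lam ^ m) * f' x := by
    refine intervalIntegral.integral_congr_Ioo_of_le (by push_cast; linarith) ?_
    intro x hx
    push_cast at hx
    simp only [P.one_eq_of_mem m hx]
  have hu : ∀ x : ℝ, HasDerivAt (fun x : ℝ => c * ((x : ℂ) - m) + a * lam ^ m) c x := by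
    intro x
    have h := (((hasDerivAt_id x).ofReal_comp.sub_const (m : ℂ)).const_mul c).add_const
      (a * lam ^ m)
    simpa using h
  have hfc : Continuous f := continuous_iff_continuousAt.2 fun x => (hf x).continuousAt
  rw [h1, intervalIntegral.integral_mul_deriv_eq_deriv_mul_of_hasDerivAt
    (u' := fun _ => c) (v := f) (by fun_prop) hfc.continuousOn
    (fun x _ => hu x) (fun x _ => hf x) (by simp)
    (hf'.intervalIntegrable _ _), intervalIntegral.integral_const_mul]
  push_cast
  ring

theorem integral_first (P : IsSawtoothFamily lam c a Q) {f f' : ℝ → ℂ}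
    (hf : ∀ x, HasDerivAt f (f' x) x) (hf' : Continuous f') (M : ℕ) :
    ∫ x in (0 : ℝ)..M, Q 1 x * f' x =
      a * lam ^ M * f M - a * f 0 + ∑ m ∈ Finset.range M, lam ^ (m + 1) * f (m + 1)
        - c * ∫ x in (0 : ℝ)..M, f x := by
  have hfc : Continuous f := continuous_iff_continuousAt.2 fun x => (hf x).continuousAt
  induction M with
  | zero => simp
  | succ M ih =>
    have hQ : ∀ N : ℕ, IntervalIntegrable (fun x => Q 1 x * f' x) volume 0 N := fun N =>
      (P.intervalIntegrable_one N).mul_continuousOn hf'.continuousOn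
    rw [← intervalIntegral.integral_add_adjacent_intervals (hQ M) ((hQ M).symm.trans (hQ (M + 1))),
      ← intervalIntegral.integral_add_adjacent_intervals (b := (M : ℝ))
        (hfc.intervalIntegrable _ _) (hfc.intervalIntegrable _ _),
      ih, P.integral_unit hf hf' M, Finset.sum_range_succ]
    have hj := P.jump M
    push_cast
    linear_combination (-f (M + 1)) * hj

theorem integral_succ (P : IsSawtoothFamily lam c a Q) {f f' : ℝ → ℂ}
    (hf : ∀ x, HasDerivAt f (f' x) x) (hf' : Continuous f') {j : ℕ} (hj : 1 ≤ j) {M : ℕ}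
    (hM : f M = 0) :
    ∫ x in (0 : ℝ)..M, Q j x * f x =
      - Q (j + 1) 0 * f 0 - ∫ x in (0 : ℝ)..M, Q (j + 1) x * f' x := by
  have hfc : Continuous f := continuous_iff_continuousAt.2 fun x => (hf x).continuousAt
  have hQd : ∀ x, HasDerivWithinAt (Q (j + 1)) (Q j x) (Set.Ioi x) x := fun x => by
    simpa using P.hasDeriv_right (j + 1) (by omega) x
  rw [intervalIntegral.integral_mul_deriv_eq_deriv_mul_of_hasDeriv_right
    (u := Q (j + 1)) (u' := Q j) (v := f)
    (P.continuous (j + 1) (by omega)).continuousOn hfc.continuousOn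
    (fun x _ => hQd x) (fun x _ => (hf x).hasDerivWithinAt)
    (P.intervalIntegrable hj M) (hf'.intervalIntegrable _ _), hM]
  ring

/-- The one-dimensional twisted Euler–Maclaurin formula with remainder of order `k`. -/
theorem sum_eq (P : IsSawtoothFamily lam c a Q) (f : ℕ → ℝ → ℂ) {k : ℕ} (hk : 1 ≤ k)
    (hf : ∀ j < k, ∀ x, HasDerivAt (f j) (f (j + 1) x) x) (hfc : ∀ j ≤ k, Continuous (f j))
    (M : ℕ) (hM : ∀ j ≤ k, f j M = 0) :
    ∑ m ∈ Finset.range M, lam ^ (m + 1) * f 0 (m + 1) =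
      c * (∫ x in (0 : ℝ)..M, f 0 x) + a * f 0 0
        + ∑ j ∈ Finset.Ico 2 (k + 1), Q j 0 * ((-1) ^ (j - 1) * f (j - 1) 0)
        + (-1) ^ (k - 1) * ∫ x in (0 : ℝ)..M, Q k x * f k x := by
  induction k, hk using Nat.le_induction with
  | base =>
    have h := P.integral_first (hf 0 one_pos) (hfc 1 le_rfl) M
    rw [hM 0 zero_le_one] at h
    simp only [zero_add] at h
    simp only [tsub_self, pow_zero, one_mul, Nat.reduceAdd, Finset.Ico_self, Finset.sum_empty, h]
    ring
  | succ k hk ih =>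
    rw [ih (fun j hj => hf j (by omega)) (fun j hj => hfc j (by omega))
      (fun j hj => hM j (by omega)), Finset.sum_Ico_succ_top (b := k + 1) (by omega),
      P.integral_succ (hf k (by omega)) (hfc (k + 1) le_rfl) hk (hM k (by omega))]
    obtain ⟨l, rfl⟩ : ∃ l, k = l + 1 := ⟨k - 1, by omega⟩
    simp only [Nat.add_sub_cancel]
    ring

end IsSawtoothFamily

theorem hasDerivWithinAt_comp_fract {B : ℝ → ℂ} {B' : ℂ} {x : ℝ}
    (h : HasDerivAt B B' (Int.fract x)) :
    HasDerivWithinAt (fun y => B (Int.fract y)) B' (Set.Ioi x) x := by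
  have h1 : HasDerivAt (fun y : ℝ => B (y - ⌊x⌋)) B' x := by
    have := HasDerivAt.comp_sub_const x (⌊x⌋ : ℝ) (f := B) (f' := B') h
    exact this
  refine h1.hasDerivWithinAt.congr_of_eventuallyEq ?_ rfl
  have : Set.Ioo x (⌊x⌋ + 1) ∈ nhdsWithin x (Set.Ioi x) :=
    Ioo_mem_nhdsGT (Int.lt_floor_add_one x)
  filter_upwards [this] with y hy
  have hfl : ⌊y⌋ = ⌊x⌋ := by
    rw [Int.floor_eq_iff]; exact ⟨(Int.floor_le x).trans hy.1.le, hy.2⟩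
  rw [Int.fract, hfl]

theorem periodicBernoulli_eq (m : ℕ) (x : ℝ) :
    periodicBernoulli m x = ((bernoulliFun m (Int.fract x) : ℝ) : ℂ) / m.factorial := by
  rw [periodicBernoulli, bernoulliFun, Polynomial.eval_map_algebraMap]
  congr 1
  exact Polynomial.aeval_algebraMap_apply ℂ (Int.fract x) (Polynomial.bernoulli m)

theorem isSawtoothFamily_bernoulli :
    IsSawtoothFamily 1 1 (-1 / 2) periodicBernoulli where
  continuous m hm := by
    have h : Continuous fun x : ℝ => bernoulliFun m (Int.fract x) := by
      have := ContinuousOn.comp_fract (s := fun x : ℝ => x)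
        (f := fun (_ : ℝ) (y : ℝ) => bernoulliFun m y)
        (by fun_prop) continuous_id
        (fun _ => (bernoulliFun_endpoints_eq_of_ne_one (by omega)).symm)
      exact this
    rw [funext (periodicBernoulli_eq m)]
    fun_prop
  hasDeriv_right m hm x := by
    obtain ⟨l, rfl⟩ : ∃ l, m = l + 1 := ⟨m - 1, by omega⟩
    rw [funext (periodicBernoulli_eq (l + 1)), Nat.add_sub_cancel]
    refine hasDerivWithinAt_comp_fract
      (B := fun y => ((bernoulliFun (l + 1) y : ℝ) : ℂ) / (l + 1).factorial) ?_
    convert! (hasDerivAt_bernoulliFun (l + 1) (Int.fract x)).ofReal_comp.div_const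
      ((l + 1).factorial : ℂ) using 1
    rw [periodicBernoulli_eq, Nat.factorial_succ]
    have : (l.factorial : ℂ) ≠ 0 := by exact_mod_cast l.factorial_ne_zero
    have : (l : ℂ) + 1 ≠ 0 := by exact_mod_cast l.succ_ne_zero
    push_cast
    field_simp
  one_eq x := by
    rw [periodicBernoulli_eq, bernoulliFun_one]
    push_cast
    simp
    ring
  jump m := by
    norm_num

theorem isSawtoothFamily_of_ne_one {lam : ℂ} (h0 : lam ≠ 0) (h1 : lam ≠ 1) {Q : ℕ → ℝ → ℂ}
    (hQ1 : ∀ x : ℝ, Q 1 x = lam ^ (⌊x⌋ + 1) / (1 - lam))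
    (hQ : ∀ m, 2 ≤ m → Continuous (Q m) ∧
      ∀ x : ℝ, Q m x = Q m 0 + ∫ t in (0 : ℝ)..x, Q (m - 1) t) :
    IsSawtoothFamily lam 0 (lam / (1 - lam)) Q := by
  have hne : (1 : ℂ) - lam ≠ 0 := sub_ne_zero.2 h1.symm
  have hone : Q 1 = fun x : ℝ => lam ^ (⌊x⌋ + 1) / (1 - lam) := funext hQ1
  have hmeas : Measurable (Q 1) := by
    rw [hone]
    exact (measurable_from_top (f := fun m : ℤ => lam ^ (m + 1) / (1 - lam))).comp
      Int.measurable_floor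
  have hint : ∀ x : ℝ, IntervalIntegrable (Q 1) volume 0 x := by
    intro x
    rw [intervalIntegrable_iff]
    obtain ⟨C, hC⟩ : ∃ C, ∀ m ∈ Set.Icc (⌊min 0 x⌋) (⌊max 0 x⌋),
        ‖lam ^ (m + 1) / (1 - lam)‖ ≤ C :=
      ((Set.finite_Icc _ _).image fun m : ℤ => ‖lam ^ (m + 1) / (1 - lam)‖).bddAbove.imp
        fun C hC m hm => hC ⟨m, hm, rfl⟩
    refine IntegrableOn.of_bound (by simp [Set.uIoc]) hmeas.aestronglyMeasurable C ?_
    refine (ae_restrict_iff' measurableSet_uIoc).2 (Filter.Eventually.of_forall fun y hy => ?_)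
    rw [hQ1]
    exact hC _ ⟨Int.floor_le_floor hy.1.le, Int.floor_le_floor hy.2⟩
  refine ⟨fun m hm => (hQ m hm).1, fun m hm x => ?_, fun x => ?_, fun m => ?_⟩
  · rw [funext (hQ m hm).2]
    refine HasDerivWithinAt.const_add _ ?_
    rcases hm.eq_or_lt with rfl | hm
    · refine (intervalIntegral.integral_hasDerivWithinAt_right (s := Set.Ici x)
        (t := Set.Ioi x) (hint x) hmeas.stronglyMeasurable.stronglyMeasurableAtFilter ?_).mono
        Set.Ioi_subset_Ici_self
      simp only [hone]
      have : Set.Ioo x (⌊x⌋ + 1) ∈ nhdsWithin x (Set.Ioi x) :=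
        Ioo_mem_nhdsGT (Int.lt_floor_add_one x)
      refine (continuousWithinAt_const (b := lam ^ (⌊x⌋ + 1) / (1 - lam))).congr_of_eventuallyEq
        ?_ rfl
      filter_upwards [this] with y hy
      have hfl : ⌊y⌋ = ⌊x⌋ := by
        rw [Int.floor_eq_iff]; exact ⟨(Int.floor_le x).trans hy.1.le, hy.2⟩
      rw [hfl]
    · have hc := (hQ (m - 1) (by omega)).1
      exact (hc.integral_hasStrictDerivAt 0 x).hasDerivAt.hasDerivWithinAt
  · rw [hQ1, zpow_add_one₀ h0]
    ring
  · field_simp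
    ring

/-- The coefficients of `N_q^{k,λ}` in terms of the sawtooth data of the family `Q`. -/
theorem IsQFamily.exists_isSawtoothFamily {lam : ℂ} {Q : ℕ → ℝ → ℂ} (hQ : IsQFamily lam Q)
    (h0 : lam ≠ 0) (q : ℂ) {k : ℕ} (hk : 1 < k) :
    ∃ c a, IsSawtoothFamily lam c a Q ∧ Ncoeff q lam Q k 0 = c ∧ Ncoeff q lam Q k 1 = q + a ∧
      ∀ j, 2 ≤ j → j ≤ k → Ncoeff q lam Q k j = Q j 0 := by
  rw [IsQFamily] at hQ
  split_ifs at hQ with h1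
  · subst h1
    obtain rfl : Q = periodicBernoulli := funext fun m => funext (hQ m)
    refine ⟨1, -1 / 2, isSawtoothFamily_bernoulli, ?_, ?_, fun j hj hjk => ?_⟩
    · simp [Ncoeff, chiCoeff, toddCoeff]
    · have : 1 ≤ 2 * (k / 2) := by omega
      simp [Ncoeff, chiCoeff, toddCoeff, this]
      ring
    · have hQj : periodicBernoulli j 0 = toddCoeff j := by
        rw [periodicBernoulli_eq, Int.fract_zero, bernoulliFun_eval_zero,
          bernoulli_eq_bernoulli'_of_ne_one (by omega), toddCoeff]
        simp
      rcases Nat.even_or_odd j with he | ho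
      · have : j ≤ 2 * (k / 2) := by
          obtain ⟨r, rfl⟩ := he
          omega
        rw [hQj, Ncoeff, if_pos rfl, if_pos this, chiCoeff, he.neg_one_pow]
        ring
      · have hz : toddCoeff j = 0 := by
          simp [toddCoeff, bernoulli'_eq_zero_of_odd ho (by omega)]
        simp [hQj, Ncoeff, chiCoeff, hz]
  · refine ⟨0, lam / (1 - lam),
      isSawtoothFamily_of_ne_one h0 h1 hQ.1 fun m hm => ⟨(hQ.2 m hm).1, (hQ.2 m hm).2.1⟩,
      ?_, ?_, fun j hj hjk => ?_⟩
    · simp [Ncoeff, h1]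
    · simp [Ncoeff, h1]
    · have : j ≠ 1 := by omega
      simp [Ncoeff, h1, this, hj, hjk]

/-! ### Measures, weights and orders attached to one coordinate -/

/-- The sum of the Dirac masses at the natural numbers. -/
noncomputable def natLattice : Measure ℝ := Measure.map ((↑) : ℕ → ℝ) Measure.count

theorem measurable_natCast_real : Measurable ((↑) : ℕ → ℝ) := measurable_from_top

instance : IsLocallyFiniteMeasure natLattice := by
  have : IsFiniteMeasureOnCompacts natLattice := by
    refine ⟨fun K hK => ?_⟩
    rw [natLattice, Measure.map_apply measurable_natCast_real hK.measurableSet,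
      Measure.count_apply_lt_top]
    exact (Nat.isClosedEmbedding_coe_real.isCompact_preimage hK).finite_of_discrete
  infer_instance

/-- The kind of functional applied in one coordinate: `none` is the weighted lattice sum,
`some (true, 0)` the integral over the half-line, `some (true, j + 1)` the derivative of order
`j` at the end point, and `some (false, 0)` the remainder integral. -/
abbrev CoordKind := Option (Bool × ℕ)

/-- The measure carrying a functional of the given kind. -/
noncomputable def coordMeasure : CoordKind → Measure ℝ
  | none => natLattice
  | some (_, j) => if j = 0 then volume.restrict (Set.Ici 0) else Measure.dirac 0

instance (c : CoordKind) : IsLocallyFiniteMeasure (coordMeasure c) := by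
  rcases c with _ | ⟨b, j⟩
  · exact inferInstanceAs (IsLocallyFiniteMeasure natLattice)
  · rw [coordMeasure]
    split_ifs <;> infer_instance

/-- The density of a functional of the given kind. -/
noncomputable def coordWeight (q lam : ℂ) (Q : ℕ → ℝ → ℂ) (k : ℕ) : CoordKind → ℝ → ℂ
  | none => fun x => (1 + (q - 1) * (max 0 (1 - x) : ℝ)) * lam ^ (x : ℂ)
  | some (true, j) => fun _ => (-1) ^ (j - 1)
  | some (false, _) => Q k

/-- The order of differentiation in a functional of the given kind. -/
def coordOrder (k : ℕ) : CoordKind → ℕ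
  | none => 0
  | some (true, j) => j - 1
  | some (false, _) => k

/-- The coefficient of a functional in the expansion of the weighted lattice sum. -/
noncomputable def coordCoeff (q lam : ℂ) (Q : ℕ → ℝ → ℂ) (k : ℕ) : Bool × ℕ → ℂ
  | (true, j) => Ncoeff q lam Q k j
  | (false, j) => if j = 0 then (-1) ^ (k - 1) else 0

theorem continuous_coordWeight (q : ℂ) {lam : ℂ} (h0 : lam ≠ 0) {Q : ℕ → ℝ → ℂ} {k : ℕ}
    (hQ : Continuous (Q k)) (c : CoordKind) : Continuous (coordWeight q lam Q k c) := by
  rcases c with _ | ⟨_ | _, j⟩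
  · have : Continuous fun x : ℝ => lam ^ (x : ℂ) :=
      Continuous.const_cpow Complex.continuous_ofReal (Or.inl h0)
    simp only [coordWeight]
    fun_prop
  · exact hQ
  · exact continuous_const

theorem coordWeight_none_natCast (q lam : ℂ) (Q : ℕ → ℝ → ℂ) (k m : ℕ) :
    coordWeight q lam Q k none m = (if m = 0 then q else 1) * lam ^ m := by
  simp only [coordWeight]
  rw [Complex.ofReal_natCast, Complex.cpow_natCast]
  split_ifs with h
  · simp [h]
  · have : (1 : ℝ) - m ≤ 0 := by
      have : (1 : ℝ) ≤ m := by exact_mod_cast Nat.one_le_iff_ne_zero.2 h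
      linarith
    simp [max_eq_left this]

theorem integral_natLattice {F : ℝ → ℂ} (hF : Continuous F) {M : ℕ}
    (hM : ∀ x : ℝ, M ≤ x → F x = 0) :
    ∫ x, F x ∂natLattice = ∑ m ∈ Finset.range M, F m := by
  have hz : ∀ m ∉ Finset.range M, F ((m : ℕ) : ℝ) = 0 := fun m hm =>
    hM m (by simpa using hm)
  rw [natLattice, integral_map measurable_natCast_real.aemeasurable hF.aestronglyMeasurable,
    integral_countable, ← tsum_eq_sum (L := SummationFilter.unconditional ℕ) hz]
  · simp [measureReal_def]
  · exact integrable_count_iff.2 (summable_of_ne_finset_zero (s := Finset.range M)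
      fun m hm => by simp [hz m hm])

theorem integral_Ici_eq_intervalIntegral {F : ℝ → ℂ} {M : ℝ} (h0 : 0 ≤ M)
    (hM : ∀ x, M ≤ x → F x = 0) : ∫ x in Set.Ici 0, F x = ∫ x in (0 : ℝ)..M, F x := by
  rw [integral_Ici_eq_integral_Ioi, intervalIntegral.integral_of_le h0]
  refine setIntegral_eq_of_subset_of_forall_sdiff_eq_zero measurableSet_Ioi
    Set.Ioc_subset_Ioi_self ?_
  intro x hx
  refine hM x ?_
  by_contra h
  exact hx.2 ⟨hx.1, (not_le.1 h).le⟩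

/-- The one-dimensional formula as an identity between the functionals of the various kinds. -/
theorem integral_coordWeight_none {lam : ℂ} {Q : ℕ → ℝ → ℂ} (hQ : IsQFamily lam Q)
    (h0 : lam ≠ 0) (q : ℂ) {k : ℕ} (hk : 1 < k) {f : ℕ → ℝ → ℂ}
    (hf : ∀ j < k, ∀ x, HasDerivAt (f j) (f (j + 1) x) x) (hfc : ∀ j ≤ k, Continuous (f j))
    {K : Set ℝ} (hK : IsCompact K) (hfK : ∀ j, ∀ x ∉ K, f j x = 0) :
    ∫ x, coordWeight q lam Q k none x * f 0 x ∂natLattice =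
      ∑ c ∈ Finset.univ ×ˢ Finset.range (k + 1), coordCoeff q lam Q k c *
        ∫ x, coordWeight q lam Q k (some c) x * f (coordOrder k (some c)) x
          ∂coordMeasure (some c) := by
  obtain ⟨c, a, P, hN0, hN1, hN⟩ := hQ.exists_isSawtoothFamily h0 q hk
  obtain ⟨R, hR⟩ := hK.bddAbove
  obtain ⟨M, hM⟩ := exists_nat_gt R
  have hz : ∀ j, ∀ x : ℝ, M ≤ x → f j x = 0 := fun j x hx => hfK j x fun hxK =>
    absurd (hR hxK) (not_le.2 (hM.trans_le hx))
  have hW := continuous_coordWeight q h0 (P.continuous k hk) none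
  rw [integral_natLattice (F := fun x => coordWeight q lam Q k none x * f 0 x)
    (hW.mul (hfc 0 (by omega))) (M := M + 1)
    (fun x hx => by rw [hz 0 x (by push_cast at hx; linarith), mul_zero]),
    Finset.sum_range_succ']
  simp only [coordWeight_none_natCast]
  have hsum := P.sum_eq f hk.le hf hfc M (fun j _ => hz j M le_rfl)
  have hlat : ∑ m ∈ Finset.range M,
      ((if m + 1 = 0 then q else 1) * lam ^ (m + 1)) * f 0 ((m + 1 : ℕ) : ℝ) =
      ∑ m ∈ Finset.range M, lam ^ (m + 1) * f 0 (m + 1) :=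
    Finset.sum_congr rfl fun m _ => by simp
  have htop : ∑ j ∈ Finset.Ico 2 (k + 1), Ncoeff q lam Q k j * ((-1) ^ (j - 1) * f (j - 1) 0) =
      ∑ j ∈ Finset.Ico 2 (k + 1), Q j 0 * ((-1) ^ (j - 1) * f (j - 1) 0) :=
    Finset.sum_congr rfl fun j hj => by
      rw [Finset.mem_Ico] at hj
      rw [hN j hj.1 (by omega)]
  have hD : ∀ j ∈ Finset.Ico 2 (k + 1), coordCoeff q lam Q k (true, j) *
      ∫ x, coordWeight q lam Q k (some (true, j)) x * f (coordOrder k (some (true, j))) x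
          ∂coordMeasure (some (true, j)) =
      Ncoeff q lam Q k j * ((-1) ^ (j - 1) * f (j - 1) 0) := by
    intro j hj
    rw [Finset.mem_Ico] at hj
    have : j ≠ 0 := by omega
    simp [coordCoeff, coordWeight, coordMeasure, coordOrder, this]
  have hRem : ∑ j ∈ Finset.range (k + 1), coordCoeff q lam Q k (false, j) *
      ∫ x, coordWeight q lam Q k (some (false, j)) x * f (coordOrder k (some (false, j))) x
          ∂coordMeasure (some (false, j)) =
      (-1) ^ (k - 1) * ∫ x in (0 : ℝ)..M, Q k x * f k x := by
    rw [Finset.sum_eq_single 0]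
    · simp only [coordCoeff, coordWeight, coordMeasure, coordOrder, if_true]
      rw [integral_Ici_eq_intervalIntegral (Nat.cast_nonneg M)
        (fun x hx => by rw [hz k x hx, mul_zero])]
    · intro j _ hj
      simp [coordCoeff, hj]
    · simp
  have hsplit : ∀ u : ℕ → ℂ, ∑ j ∈ Finset.range (k + 1), u j =
      u 0 + (u 1 + ∑ j ∈ Finset.Ico 2 (k + 1), u j) := fun u => by
    rw [Finset.range_eq_Ico, Finset.sum_eq_sum_Ico_succ_bot (by omega),
      Finset.sum_eq_sum_Ico_succ_bot (by omega)]
  rw [Finset.sum_product, Fintype.sum_bool, hRem, hsplit, Finset.sum_congr rfl hD, htop, hlat,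
    hsum]
  have h00 := integral_Ici_eq_intervalIntegral (F := f 0) (Nat.cast_nonneg M) (hz 0)
  simp only [coordCoeff, coordWeight, coordMeasure, coordOrder, hN0, hN1, h00, if_true,
    one_ne_zero, if_false, integral_dirac, Nat.cast_zero, pow_zero, zero_tsub, tsub_self, one_mul]
  ring

/-! ### Continuous partial derivatives -/

/-- A function with continuous partial derivatives is differentiable. -/
theorem hasFDerivAt_of_continuous_partial {n : ℕ} {U : (Fin n → ℝ) → ℂ}
    {D : Fin n → (Fin n → ℝ) → ℂ}
    (hU : ∀ i h x, HasDerivAt (fun x => U (Function.update h i x)) (D i (Function.update h i x)) x)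
    (hD : ∀ i, Continuous (D i)) (h : Fin n → ℝ) :
    HasFDerivAt U
      (∑ i, (ContinuousLinearMap.proj (R := ℝ) (φ := fun _ : Fin n => ℝ) i).smulRight (D i h))
      h := by
  have key : ∀ S : Finset (Fin n),
      (fun v : Fin n → ℝ => U (fun l => if l ∈ S then h l + v l else h l) - U h
        - ∑ i ∈ S, v i • D i h) =o[nhds 0] fun v => v := by
    intro S
    induction S using Finset.induction_on with
    | empty => simp
    | insert i S hi ih =>
      have hstep : (fun v : Fin n → ℝ => U (fun l => if l ∈ insert i S then h l + v l else h l)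
          - U (fun l => if l ∈ S then h l + v l else h l) - v i • D i h) =o[nhds 0]
            fun v => v := by
        rw [Asymptotics.isLittleO_iff]
        intro ε hε
        obtain ⟨δ, hδ, hball⟩ := Metric.continuous_iff.1 (hD i) h ε hε
        filter_upwards [Metric.ball_mem_nhds (0 : Fin n → ℝ) hδ] with v hv
        rw [mem_ball_zero_iff] at hv
        set w : Fin n → ℝ := fun l => if l ∈ S then h l + v l else h l with hw
        have h1 : (fun l => if l ∈ insert i S then h l + v l else h l) =
            Function.update w i (h i + v i) := by
          funext l
          rcases eq_or_ne l i with rfl | hl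
          · simp
          · simp [hw, hl]
        have h2 : w = Function.update w i (h i) := by
          simp [hw, hi]
        have hderiv : ∀ x ∈ Set.uIcc (h i) (h i + v i),
            HasDerivWithinAt (fun x : ℝ => U (Function.update w i x) - x • D i h)
              (D i (Function.update w i x) - D i h) (Set.uIcc (h i) (h i + v i)) x := by
          intro x _
          have := (hU i w x).sub ((hasDerivAt_id x).smul_const (D i h))
          simp only [one_smul] at this
          exact this.hasDerivWithinAt
        have hbound : ∀ x ∈ Set.uIcc (h i) (h i + v i),
            ‖D i (Function.update w i x) - D i h‖ ≤ ε := by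
          intro x hx
          rw [← dist_eq_norm]
          refine (hball _ ((dist_pi_lt_iff hδ).2 fun l => ?_)).le
          have hvl : |v l| < δ := (norm_le_pi_norm v l).trans_lt hv
          rcases eq_or_ne l i with rfl | hl
          · rw [Function.update_self, Real.dist_eq]
            refine lt_of_le_of_lt ?_ hvl
            simpa using Set.abs_sub_left_of_mem_uIcc hx
          · rw [Function.update_of_ne hl, hw, Real.dist_eq]
            dsimp only
            split_ifs
            · simpa using hvl
            · simpa using hδ
        have hmv := (convex_uIcc (h i) (h i + v i)).norm_image_sub_le_of_norm_hasDerivWithin_le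
          hderiv hbound Set.left_mem_uIcc Set.right_mem_uIcc
        rw [h1]
        nth_rewrite 2 [h2]
        calc _ = ‖U (Function.update w i (h i + v i)) - (h i + v i) • D i h
              - (U (Function.update w i (h i)) - h i • D i h)‖ := by
              congr 1
              rw [add_smul]
              abel
          _ ≤ ε * ‖h i + v i - h i‖ := hmv
          _ ≤ ε * ‖v‖ := by
              rw [add_sub_cancel_left]
              exact mul_le_mul_of_nonneg_left (norm_le_pi_norm v i) hε.le
      refine (hstep.add ih).congr_left fun v => ?_
      rw [Finset.sum_insert hi]
      abel
  rw [hasFDerivAt_iff_isLittleO_nhds_zero]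
  refine (key Finset.univ).congr_left fun v => ?_
  simp
  rfl

/-! ### Integrals against translated product measures -/

section Pi

variable {n : ℕ}

theorem isLocallyFiniteMeasure_update (ν : Fin n → Measure ℝ) [∀ l, IsLocallyFiniteMeasure (ν l)]
    (i : Fin n) (ρ : Measure ℝ) [IsLocallyFiniteMeasure ρ] (l : Fin n) :
    IsLocallyFiniteMeasure (Function.update ν i ρ l) := by
  rcases eq_or_ne l i with rfl | hl
  · simpa
  · simp only [Function.update_of_ne hl]
    infer_instance

attribute [local instance] isLocallyFiniteMeasure_update

/-- Splitting off the `i`-th coordinate of a product measure. -/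
theorem map_update_prod_pi (ν : Fin n → Measure ℝ) [∀ l, IsLocallyFiniteMeasure (ν l)]
    (i : Fin n) :
    Measure.map (fun p : (Fin n → ℝ) × ℝ => Function.update p.1 i p.2)
      ((Measure.pi (Function.update ν i (Measure.dirac 0))).prod (ν i)) = Measure.pi ν := by
  have hm : Measurable fun p : (Fin n → ℝ) × ℝ => Function.update p.1 i p.2 :=
    (continuous_fst.update i continuous_snd).measurable
  symm
  refine Measure.pi_eq fun s hs => ?_
  rw [Measure.map_apply hm (MeasurableSet.univ_pi hs)]
  have hpre : (fun p : (Fin n → ℝ) × ℝ => Function.update p.1 i p.2) ⁻¹' Set.univ.pi s =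
      (Set.univ.pi (Function.update s i Set.univ)) ×ˢ s i := by
    ext p
    simp only [Set.mem_preimage, Set.mem_univ_pi, Set.mem_prod]
    constructor
    · intro h
      refine ⟨fun l => ?_, by simpa using h i⟩
      rcases eq_or_ne l i with rfl | hl
      · simp
      · simpa [hl] using h l
    · rintro ⟨h, hi⟩ l
      rcases eq_or_ne l i with rfl | hl
      · simpa
      · simpa [hl] using h l
  rw [hpre, Measure.prod_prod, Measure.pi_pi, ← Finset.prod_erase_mul _ _ (Finset.mem_univ i),
    ← Finset.prod_erase_mul _ (fun l => ν l (s l)) (Finset.mem_univ i)]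
  simp only [Function.update_self, measure_univ, mul_one]
  congr 1
  refine Finset.prod_congr rfl fun l hl => ?_
  simp [Finset.ne_of_mem_erase hl]

variable {Φ Ψ : (Fin n → ℝ) → ℂ}

theorem integrable_update_prod (ν : Fin n → Measure ℝ) [∀ l, IsLocallyFiniteMeasure (ν l)]
    (i : Fin n) (hΦ : Continuous Φ) (hc : HasCompactSupport Φ) :
    Integrable (fun p : (Fin n → ℝ) × ℝ => Φ (Function.update p.1 i p.2))
      ((Measure.pi (Function.update ν i (Measure.dirac 0))).prod (ν i)) := by
  have hm : Measurable fun p : (Fin n → ℝ) × ℝ => Function.update p.1 i p.2 :=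
    (continuous_fst.update i continuous_snd).measurable
  have h : Integrable Φ (Measure.pi ν) := hΦ.integrable_of_hasCompactSupport hc
  rw [← map_update_prod_pi ν i] at h
  exact (integrable_map_measure hΦ.aestronglyMeasurable hm.aemeasurable).1 h

theorem integral_pi_eq_prod (ν : Fin n → Measure ℝ) [∀ l, IsLocallyFiniteMeasure (ν l)]
    (i : Fin n) (hΦ : Continuous Φ) :
    ∫ t, Φ t ∂Measure.pi ν = ∫ p : (Fin n → ℝ) × ℝ, Φ (Function.update p.1 i p.2)
      ∂((Measure.pi (Function.update ν i (Measure.dirac 0))).prod (ν i)) := by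
  have hm : Measurable fun p : (Fin n → ℝ) × ℝ => Function.update p.1 i p.2 :=
    (continuous_fst.update i continuous_snd).measurable
  rw [← integral_map (φ := fun p : (Fin n → ℝ) × ℝ => Function.update p.1 i p.2)
    hm.aemeasurable hΦ.aestronglyMeasurable, map_update_prod_pi]

theorem integral_pi_eq_iterated (ν : Fin n → Measure ℝ) [∀ l, IsLocallyFiniteMeasure (ν l)]
    (i : Fin n) (hΦ : Continuous Φ) (hc : HasCompactSupport Φ) :
    ∫ t, Φ t ∂Measure.pi ν = ∫ t, ∫ x, Φ (Function.update t i x) ∂ν i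
      ∂Measure.pi (Function.update ν i (Measure.dirac 0)) := by
  rw [integral_pi_eq_prod ν i hΦ, integral_prod _ (integrable_update_prod ν i hΦ hc)]

theorem HasCompactSupport.comp_sub_const (hc : HasCompactSupport Φ) (h : Fin n → ℝ) :
    HasCompactSupport fun t => Φ (t - h) :=
  hc.comp_homeomorph (Homeomorph.subRight h)

theorem HasCompactSupport.comp_update (hc : HasCompactSupport Φ) (t : Fin n → ℝ) (i : Fin n) :
    HasCompactSupport fun x => Φ (Function.update t i x) := by
  refine HasCompactSupport.intro (hc.isCompact.image (continuous_apply i)) fun x hx => ?_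
  refine image_eq_zero_of_notMem_tsupport fun h => hx ⟨_, h, by simp⟩

/-- The integral of a translate of `Φ` against a product measure. -/
noncomputable def shiftIntegral (Φ : (Fin n → ℝ) → ℂ) (ν : Fin n → Measure ℝ)
    (h : Fin n → ℝ) : ℂ := ∫ t, Φ (t - h) ∂Measure.pi ν

theorem continuous_shiftIntegral (ν : Fin n → Measure ℝ) [∀ l, IsLocallyFiniteMeasure (ν l)]
    (hΦ : Continuous Φ) (hc : HasCompactSupport Φ) : Continuous (shiftIntegral Φ ν) := by
  have hc' : HasCompactSupport fun t => Φ (-t) := hc.comp_homeomorph (Homeomorph.neg _)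
  have h := hc'.continuous_convolution_right (ContinuousLinearMap.lsmul ℝ ℝ)
    (f := fun _ => (1 : ℝ)) (μ := Measure.pi ν) (locallyIntegrable_const 1) (by fun_prop)
  refine h.congr fun x => ?_
  simp [shiftIntegral, MeasureTheory.convolution]

theorem update_sub_update (t h : Fin n → ℝ) (i : Fin n) (s x : ℝ) :
    Function.update t i s - Function.update h i x =
      Function.update t i 0 - Function.update h i (x - s) := by
  funext l
  rcases eq_or_ne l i with rfl | hl
  · simp
  · simp [hl]

theorem shiftIntegral_update_dirac (ν : Fin n → Measure ℝ) [∀ l, IsLocallyFiniteMeasure (ν l)]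
    (i : Fin n) (hΦ : Continuous Φ) (hc : HasCompactSupport Φ) (h : Fin n → ℝ) :
    shiftIntegral Φ (Function.update ν i (Measure.dirac 0)) h =
      ∫ t, Φ (Function.update t i 0 - h)
        ∂Measure.pi (Function.update ν i (Measure.dirac 0)) := by
  rw [shiftIntegral, integral_pi_eq_iterated _ i (by fun_prop) (hc.comp_sub_const h)]
  simp only [Function.update_idem, Function.update_self, integral_dirac]

theorem shiftIntegral_update (ν : Fin n → Measure ℝ) [∀ l, IsLocallyFiniteMeasure (ν l)]
    (i : Fin n) (ρ : Measure ℝ) [IsLocallyFiniteMeasure ρ] (hΦ : Continuous Φ)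
    (hc : HasCompactSupport Φ) (h : Fin n → ℝ) (x : ℝ) :
    Integrable (fun s => shiftIntegral Φ (Function.update ν i (Measure.dirac 0))
      (Function.update h i (x - s))) ρ ∧
    shiftIntegral Φ (Function.update ν i ρ) (Function.update h i x) =
      ∫ s, shiftIntegral Φ (Function.update ν i (Measure.dirac 0))
        (Function.update h i (x - s)) ∂ρ := by
  have hΦ' : Continuous fun t => Φ (t - Function.update h i x) := by fun_prop
  have hint := integrable_update_prod (Function.update ν i ρ) i hΦ'
    (hc.comp_sub_const (Function.update h i x))
  have heq := integral_pi_eq_prod (Function.update ν i ρ) i hΦ'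
  simp only [Function.update_idem, Function.update_self] at hint heq
  simp only [shiftIntegral_update_dirac ν i hΦ hc, ← update_sub_update]
  exact ⟨hint.integral_prod_right, heq.trans (integral_prod_symm _ hint)⟩

/-- Differentiating the integral over a half-line in its end point gives a Dirac mass there. -/
theorem hasDerivAt_shiftIntegral_Ici (ν : Fin n → Measure ℝ)
    [∀ l, IsLocallyFiniteMeasure (ν l)] (i : Fin n) (hΦ : Continuous Φ)
    (hc : HasCompactSupport Φ) (h : Fin n → ℝ) (x : ℝ) :
    HasDerivAt (fun x => shiftIntegral Φ
        (Function.update ν i (volume.restrict (Set.Ici 0))) (Function.update h i x))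
      (shiftIntegral Φ (Function.update ν i (Measure.dirac 0)) (Function.update h i x)) x := by
  set θ : ℝ → ℂ := fun y =>
    shiftIntegral Φ (Function.update ν i (Measure.dirac 0)) (Function.update h i y) with hθ
  have hθc : Continuous θ :=
    (continuous_shiftIntegral _ hΦ hc).comp (continuous_const.update i continuous_id)
  have hθi : Integrable θ := by
    have := (shiftIntegral_update ν i volume hΦ hc h 0).1.comp_sub_left 0
    simpa using this
  have hF : ∀ x, shiftIntegral Φ (Function.update ν i (volume.restrict (Set.Ici 0)))
      (Function.update h i x) = (∫ y in Set.Iic 0, θ y) + ∫ y in (0 : ℝ)..x, θ y := by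
    intro x
    rw [(shiftIntegral_update ν i (volume.restrict (Set.Ici 0)) hΦ hc h x).2]
    have h1 := (Measure.measurePreserving_sub_left volume x).setIntegral_preimage_emb
      (MeasurableEquiv.subLeft x).measurableEmbedding θ (Set.Iic x)
    have h2 : (fun s => x - s) ⁻¹' Set.Iic x = Set.Ici 0 := by
      ext s
      simp
    rw [h2] at h1
    rw [← intervalIntegral.integral_Iic_sub_Iic hθi.integrableOn hθi.integrableOn,
      add_sub_cancel, ← h1]
  simp only [hF]
  exact (hθc.integral_hasStrictDerivAt 0 x).hasDerivAt.const_add _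

theorem shiftIntegral_dirac_eq_Ici (ν : Fin n → Measure ℝ)
    [∀ l, IsLocallyFiniteMeasure (ν l)] (i : Fin n) (hΦ : Continuous Φ)
    (hc : HasCompactSupport Φ) (hΨ : Continuous Ψ) (hcΨ : HasCompactSupport Ψ)
    (hd : ∀ t x, HasDerivAt (fun x => Φ (Function.update t i x)) (-Ψ (Function.update t i x)) x)
    (h : Fin n → ℝ) :
    shiftIntegral Φ (Function.update ν i (Measure.dirac 0)) h =
      shiftIntegral Ψ (Function.update ν i (volume.restrict (Set.Ici 0))) h := by
  rw [shiftIntegral_update_dirac ν i hΦ hc, shiftIntegral,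
    integral_pi_eq_iterated _ i (by fun_prop) (hcΨ.comp_sub_const h)]
  simp only [Function.update_idem, Function.update_self]
  congr 1 with t
  have hup : ∀ s, Function.update t i s - h = Function.update (t - h) i (s - h i) := by
    intro s
    funext l
    rcases eq_or_ne l i with rfl | hl
    · simp
    · simp [hl]
  have hd' : ∀ s, HasDerivAt (fun s => Φ (Function.update t i s - h))
      (-Ψ (Function.update t i s - h)) s := by
    intro s
    simp only [hup]
    exact (hd (t - h) (s - h i)).comp_sub_const s (h i)
  have hcs := (hc.comp_sub_const h).comp_update t i
  have hcsΨ := (hcΨ.comp_sub_const h).comp_update t i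
  have hu : Continuous fun s => Function.update t i s - h :=
    Continuous.sub (f := fun s => Function.update t i s)
      (continuous_const.update i continuous_id) continuous_const
  have hcont : Continuous fun s => Ψ (Function.update t i s - h) := hΨ.comp hu
  have hint : Integrable fun s => -Ψ (Function.update t i s - h) :=
    (hcont.integrable_of_hasCompactSupport hcsΨ).neg
  have hlim : Filter.Tendsto (fun s => Φ (Function.update t i s - h)) Filter.atTop (nhds 0) := by
    have h2 := hasCompactSupport_iff_eventuallyEq.1 hcs
    rw [Filter.coclosedCompact_eq_cocompact] at h2
    exact (h2.filter_mono atTop_le_cocompact).tendsto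
  have := integral_Ioi_of_hasDerivAt_of_tendsto (a := 0)
    (hd' 0).continuousAt.continuousWithinAt (fun s _ => hd' s) hint.integrableOn hlim
  rw [integral_Ici_eq_integral_Ioi]
  rw [integral_neg] at this
  linear_combination this

end Pi

/-! ### Mixed partial derivatives -/

section MixedPartial

variable {n : ℕ} {H : (Fin n → ℝ) → ℂ}

theorem ContDiff.coordPartial {m : ℕ} (hH : ContDiff ℝ (m + 1 : ℕ) H) (i : Fin n) :
    ContDiff ℝ m (coordPartial i H) :=
  (hH.fderiv_right (by exact_mod_cast le_rfl)).clm_apply contDiff_const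

theorem ContDiff.iterate_coordPartial {m j : ℕ} (hH : ContDiff ℝ (m + j : ℕ) H) (i : Fin n) :
    ContDiff ℝ m ((_root_.coordPartial i)^[j] H) := by
  induction j generalizing m with
  | zero => exact hH
  | succ j ih =>
    rw [Function.iterate_succ_apply']
    exact ContDiff.coordPartial (ih (by rwa [add_assoc, add_comm 1 j])) i

theorem ContDiff.foldr_coordPartial {m : ℕ} (a : Fin n → ℕ) (L : List (Fin n))
    (hH : ContDiff ℝ (m + (L.map a).sum : ℕ) H) :
    ContDiff ℝ m (L.foldr (fun i G => (_root_.coordPartial i)^[a i] G) H) := by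
  induction L generalizing m with
  | nil => simpa using hH
  | cons l L ih =>
    rw [List.foldr_cons]
    refine ContDiff.iterate_coordPartial (ih ?_) l
    rwa [List.map_cons, List.sum_cons, ← add_assoc] at hH

theorem ContDiff.mixedPartial {m : ℕ} {a : Fin n → ℕ}
    (hH : ContDiff ℝ (m + ∑ i, a i : ℕ) H) : ContDiff ℝ m (mixedPartial a H) := by
  refine ContDiff.foldr_coordPartial a _ ?_
  rwa [← List.ofFn_eq_map, List.sum_ofFn]

theorem coordPartial_comm (hH : ContDiff ℝ 2 H) (i l : Fin n) :
    coordPartial i (coordPartial l H) = coordPartial l (coordPartial i H) := by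
  have hd : Differentiable ℝ (fderiv ℝ H) :=
    (hH.fderiv_right (m := 1) (by norm_num)).differentiable one_ne_zero
  have h2 : ∀ (i l : Fin n) x, coordPartial i (coordPartial l H) x =
      fderiv ℝ (fderiv ℝ H) x (Pi.single i 1) (Pi.single l 1) := by
    intro i l x
    have := ((hd x).hasFDerivAt.clm_apply (hasFDerivAt_const (Pi.single l (1 : ℝ)) x)).fderiv
    rw [coordPartial]
    change fderiv ℝ (fun y => fderiv ℝ H y (Pi.single l 1)) x _ = _
    rw [this]
    simp
  funext x
  rw [h2, h2]
  exact (hH.contDiffAt.isSymmSndFDerivAt (by simp)).eq _ _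

theorem coordPartial_iterate_comm {j : ℕ} (hH : ContDiff ℝ (j + 1 : ℕ) H) (i l : Fin n) :
    coordPartial i ((coordPartial l)^[j] H) = (coordPartial l)^[j] (coordPartial i H) := by
  induction j generalizing H with
  | zero => rfl
  | succ j ih =>
    rw [Function.iterate_succ_apply, Function.iterate_succ_apply, ih (hH.coordPartial l),
      coordPartial_comm (hH.of_le (by norm_cast; omega))]

theorem foldr_coordPartial_update (a : Fin n → ℕ) (i : Fin n) (L : List (Fin n)) (hL : L.Nodup)
    (hH : ContDiff ℝ ((L.map a).sum + 1 : ℕ) H) :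
    L.foldr (fun l G => (coordPartial l)^[Function.update a i (a i + 1) l] G) H =
      if i ∈ L then coordPartial i (L.foldr (fun l G => (coordPartial l)^[a l] G) H)
      else L.foldr (fun l G => (coordPartial l)^[a l] G) H := by
  induction L with
  | nil => simp
  | cons l L ih =>
    rw [List.nodup_cons] at hL
    rw [List.map_cons, List.sum_cons] at hH
    have hIH := ih hL.2 (hH.of_le (by norm_cast; omega))
    simp only [List.foldr_cons, hIH]
    rcases eq_or_ne l i with rfl | hl
    · simp [hL.1, Function.iterate_succ_apply']
    · simp only [Function.update_of_ne hl, List.mem_cons, hl.symm, false_or]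
      split_ifs with hi
      · rw [coordPartial_iterate_comm]
        refine ContDiff.foldr_coordPartial a L (hH.of_le ?_)
        norm_cast
        omega
      · rfl

theorem mixedPartial_update (a : Fin n → ℕ) (i : Fin n)
    (hH : ContDiff ℝ ((∑ l, a l) + 1 : ℕ) H) :
    mixedPartial (Function.update a i (a i + 1)) H = coordPartial i (mixedPartial a H) := by
  have := foldr_coordPartial_update a i (List.finRange n) (List.nodup_finRange n) (H := H)
    (by rwa [← List.ofFn_eq_map, List.sum_ofFn])
  simpa [mixedPartial] using this

theorem mixedPartial_zero (H : (Fin n → ℝ) → ℂ) : mixedPartial (fun _ => 0) H = H := by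
  have : ∀ L : List (Fin n),
      L.foldr (fun l G => (coordPartial l)^[(fun _ => 0 : Fin n → ℕ) l] G) H = H := fun L => by
    induction L with
    | nil => rfl
    | cons l L ih => simp
  exact this _

theorem tsupport_coordPartial_subset (i : Fin n) (H : (Fin n → ℝ) → ℂ) :
    tsupport (coordPartial i H) ⊆ tsupport H :=
  tsupport_fderiv_apply_subset ℝ _

theorem tsupport_mixedPartial_subset (a : Fin n → ℕ) (H : (Fin n → ℝ) → ℂ) :
    tsupport (mixedPartial a H) ⊆ tsupport H := by
  have hit : ∀ (i : Fin n) (j : ℕ) G, tsupport ((coordPartial i)^[j] G) ⊆ tsupport G := by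
    intro i j G
    induction j with
    | zero => exact subset_rfl
    | succ j ih =>
      rw [Function.iterate_succ_apply']
      exact (tsupport_coordPartial_subset i _).trans ih
  have : ∀ L : List (Fin n),
      tsupport (L.foldr (fun l G => (coordPartial l)^[a l] G) H) ⊆ tsupport H := fun L => by
    induction L with
    | nil => exact subset_rfl
    | cons l L ih => exact (hit l _ _).trans ih
  exact this _

theorem HasCompactSupport.mixedPartial (hH : HasCompactSupport H) (a : Fin n → ℕ) :
    HasCompactSupport (mixedPartial a H) :=
  hH.of_isClosed_subset (isClosed_tsupport _) (tsupport_mixedPartial_subset a H)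

theorem hasDerivAt_comp_update (hH : Differentiable ℝ H) (t : Fin n → ℝ) (i : Fin n) (x : ℝ) :
    HasDerivAt (fun x => H (Function.update t i x)) (coordPartial i H (Function.update t i x)) x :=
  (hH _).hasFDerivAt.comp_hasDerivAt x (hasDerivAt_update t i x)

end MixedPartial

/-! ### Functionals of mixed kinds on `ℝⁿ` -/

section Kinds

variable {n : ℕ} {q lam : Fin n → ℂ} {Q : Fin n → ℕ → ℝ → ℂ} {k : ℕ} {g : (Fin n → ℝ) → ℂ}

theorem sum_update_succ (a : Fin n → ℕ) (i : Fin n) :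
    ∑ l, Function.update a i (a i + 1) l = (∑ l, a l) + 1 := by
  rw [Finset.sum_update_of_mem (Finset.mem_univ i), ← Finset.add_sum_erase _ a (Finset.mem_univ i),
    Finset.sdiff_singleton_eq_erase]
  ring

theorem sum_le_mul {a : Fin n → ℕ} (ha : ∀ i, a i ≤ k) : ∑ i, a i ≤ n * k := by
  simpa using Finset.sum_le_card_nsmul Finset.univ a k fun i _ => ha i

theorem continuous_mixedPartial (hg : ContDiff ℝ (n * k : ℕ) g) {a : Fin n → ℕ}
    (ha : ∀ i, a i ≤ k) : Continuous (mixedPartial a g) := by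
  have := sum_le_mul ha
  exact (ContDiff.mixedPartial (m := 0) (hg.of_le (by norm_cast; omega))).continuous

theorem hasDerivAt_mixedPartial (hg : ContDiff ℝ (n * k : ℕ) g) {a : Fin n → ℕ}
    (ha : ∀ i, a i ≤ k) {i : Fin n} (hi : a i < k) (t : Fin n → ℝ) (x : ℝ) :
    HasDerivAt (fun x => mixedPartial a g (Function.update t i x))
      (mixedPartial (Function.update a i (a i + 1)) g (Function.update t i x)) x := by
  have hle : (∑ l, a l) + 1 ≤ n * k := by
    rw [← sum_update_succ a i]
    refine sum_le_mul fun l => ?_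
    rcases eq_or_ne l i with rfl | hl
    · simpa using hi
    · simpa [hl] using ha l
  rw [mixedPartial_update a i (hg.of_le (by exact_mod_cast hle))]
  refine hasDerivAt_comp_update (ContDiff.differentiable (n := 1) ?_ one_ne_zero) t i x
  exact_mod_cast ContDiff.mixedPartial (m := 1) (hg.of_le (by norm_cast; omega))

variable (q lam Q k g) in
/-- The integrand of the functional which is of kind `τ i` in the `i`-th coordinate. -/
noncomputable def kindIntegrand (τ : Fin n → CoordKind) (t : Fin n → ℝ) : ℂ :=
  (∏ i, coordWeight (q i) (lam i) (Q i) k (τ i) (t i)) *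
    mixedPartial (fun i => coordOrder k (τ i)) g t

variable (q lam Q k g) in
/-- The functional which is of kind `τ i` in the `i`-th coordinate, applied to the translates
of `g`. -/
noncomputable def kindIntegral (τ : Fin n → CoordKind) (h : Fin n → ℝ) : ℂ :=
  shiftIntegral (kindIntegrand q lam Q k g τ) (fun i => coordMeasure (τ i)) h

theorem continuous_kindIntegrand (h0 : ∀ i, lam i ≠ 0) (hQ : ∀ i, Continuous (Q i k))
    (hg : ContDiff ℝ (n * k : ℕ) g) {τ : Fin n → CoordKind} (hτ : ∀ i, coordOrder k (τ i) ≤ k) :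
    Continuous (kindIntegrand q lam Q k g τ) :=
  (continuous_finsetProd _ fun i _ =>
    (continuous_coordWeight (q i) (h0 i) (hQ i) (τ i)).comp (continuous_apply i)).mul
    (continuous_mixedPartial hg hτ)

theorem hasCompactSupport_kindIntegrand (hgs : HasCompactSupport g) (τ : Fin n → CoordKind) :
    HasCompactSupport (kindIntegrand q lam Q k g τ) :=
  (HasCompactSupport.mixedPartial hgs _).mul_left

theorem kindIntegrand_update (τ : Fin n → CoordKind) (i : Fin n) (c : CoordKind)
    (t : Fin n → ℝ) (x : ℝ) :
    kindIntegrand q lam Q k g (Function.update τ i c) (Function.update t i x) =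
      (∏ l ∈ Finset.univ.erase i, coordWeight (q l) (lam l) (Q l) k (τ l) (t l)) *
        (coordWeight (q i) (lam i) (Q i) k c x *
          mixedPartial (Function.update (fun l => coordOrder k (τ l)) i (coordOrder k c)) g
            (Function.update t i x)) := by
  have h1 : (fun l => coordOrder k (Function.update τ i c l)) =
      Function.update (fun l => coordOrder k (τ l)) i (coordOrder k c) := by
    funext l
    rcases eq_or_ne l i with rfl | hl
    · simp
    · simp [hl]
  rw [kindIntegrand, h1, ← Finset.prod_erase_mul _ _ (Finset.mem_univ i), Function.update_self,
    Function.update_self, mul_assoc]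
  congr 1
  refine Finset.prod_congr rfl fun l hl => ?_
  rw [Function.update_of_ne (Finset.ne_of_mem_erase hl),
    Function.update_of_ne (Finset.ne_of_mem_erase hl)]

theorem coordMeasure_update (τ : Fin n → CoordKind) (i : Fin n) (c : CoordKind) :
    (fun l => coordMeasure (Function.update τ i c l)) =
      Function.update (fun l => coordMeasure (τ l)) i (coordMeasure c) := by
  funext l
  rcases eq_or_ne l i with rfl | hl
  · simp
  · simp [hl]

theorem coordOrder_update_le {τ : Fin n → CoordKind} (hτ : ∀ i, coordOrder k (τ i) ≤ k)
    (i : Fin n) {c : CoordKind} (hc : coordOrder k c ≤ k) (l : Fin n) :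
    coordOrder k (Function.update τ i c l) ≤ k := by
  rcases eq_or_ne l i with rfl | hl
  · simpa
  · simpa [hl] using hτ l

theorem kindIntegral_update_zero (h0 : ∀ i, lam i ≠ 0) (hQ : ∀ i, Continuous (Q i k))
    (hg : ContDiff ℝ (n * k : ℕ) g) (hgs : HasCompactSupport g) {τ : Fin n → CoordKind}
    (hτ : ∀ i, coordOrder k (τ i) ≤ k) (i : Fin n) {c : CoordKind} (hc : coordOrder k c ≤ k) :
    Integrable (fun t => ∫ x, kindIntegrand q lam Q k g (Function.update τ i c)
        (Function.update t i x) ∂coordMeasure c)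
      (Measure.pi (Function.update (fun l => coordMeasure (τ l)) i (Measure.dirac 0))) ∧
    kindIntegral q lam Q k g (Function.update τ i c) 0 =
      ∫ t, ∫ x, kindIntegrand q lam Q k g (Function.update τ i c) (Function.update t i x)
          ∂coordMeasure c
        ∂Measure.pi (Function.update (fun l => coordMeasure (τ l)) i (Measure.dirac 0)) := by
  have hcont := continuous_kindIntegrand (q := q) h0 hQ hg (coordOrder_update_le hτ i hc)
  have hcs := hasCompactSupport_kindIntegrand (q := q) (lam := lam) (Q := Q) (k := k) hgs
    (Function.update τ i c)
  have h1 := integrable_update_prod (fun l => coordMeasure (Function.update τ i c l)) i hcont hcs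
  have h2 := integral_pi_eq_iterated (fun l => coordMeasure (Function.update τ i c l)) i hcont hcs
  rw [coordMeasure_update] at h1 h2
  simp only [Function.update_idem, Function.update_self] at h1 h2
  refine ⟨h1.integral_prod_left, ?_⟩
  rw [← h2, kindIntegral, shiftIntegral, coordMeasure_update]
  simp only [sub_zero]

theorem coordOrder_le_of_mem {c : Bool × ℕ} (hc : c ∈ Finset.univ ×ˢ Finset.range (k + 1)) :
    coordOrder k (some c) ≤ k := by
  rcases c with ⟨_ | _, j⟩
  · exact le_rfl
  · simp only [Finset.mem_product, Finset.mem_univ, Finset.mem_range, true_and] at hc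
    simp only [coordOrder]
    omega

/-- Applying the one-dimensional formula in a single coordinate. -/
theorem kindIntegral_eq_sum (h0 : ∀ i, lam i ≠ 0) (hk : 1 < k) (hQ : ∀ i, IsQFamily (lam i) (Q i))
    (hQc : ∀ i, Continuous (Q i k))
    (hg : ContDiff ℝ (n * k : ℕ) g) (hgs : HasCompactSupport g) {τ : Fin n → CoordKind}
    (hτ : ∀ i, coordOrder k (τ i) ≤ k) {i : Fin n} (hi : τ i = none) :
    kindIntegral q lam Q k g τ 0 = ∑ c ∈ Finset.univ ×ˢ Finset.range (k + 1),
      coordCoeff (q i) (lam i) (Q i) k c *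
        kindIntegral q lam Q k g (Function.update τ i (some c)) 0 := by
  have hstep := fun (c : CoordKind) (hc : coordOrder k c ≤ k) =>
    kindIntegral_update_zero (q := q) h0 hQc hg hgs hτ i hc
  have hτi : τ = Function.update τ i none := by rw [← hi, Function.update_eq_self]
  rw [hτi, (hstep none (Nat.zero_le k)).2, ← hτi]
  rw [Finset.sum_congr rfl fun c hc => by
    rw [(hstep (some c) (coordOrder_le_of_mem hc)).2, ← integral_const_mul]]
  rw [← integral_finsetSum _ fun c hc =>
    (hstep (some c) (coordOrder_le_of_mem hc)).1.const_mul _]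
  congr 1 with t
  have hord : ∀ j ≤ k, ∀ l,
      Function.update (fun l => coordOrder k (τ l)) i j l ≤ k := by
    intro j hj l
    rcases eq_or_ne l i with rfl | hl
    · simpa
    · simpa [hl] using hτ l
  have h1 := integral_coordWeight_none (hQ i) (h0 i) (q i) hk
    (f := fun j x => mixedPartial (Function.update (fun l => coordOrder k (τ l)) i j) g
      (Function.update t i x)) (K := (fun t => t i) '' tsupport g)
    (fun j hj x => by
      simpa using hasDerivAt_mixedPartial hg (hord j hj.le) (i := i) (by simpa using hj) t x)
    (fun j hj => (continuous_mixedPartial hg (hord j hj)).comp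
      (continuous_const.update i continuous_id))
    (hgs.isCompact.image (continuous_apply i))
    (fun j x hx => image_eq_zero_of_notMem_tsupport fun h =>
      hx ⟨_, tsupport_mixedPartial_subset _ _ h, by simp⟩)
  conv_lhs => rw [hτi]
  simp only [kindIntegrand_update, integral_const_mul]
  refine (congrArg (_ * ·) h1).trans ?_
  simp only [Finset.mul_sum]
  exact Finset.sum_congr rfl fun c _ => by ring

theorem pi_natLattice : Measure.pi (fun _ : Fin n => natLattice) =
    Measure.map (fun (m : Fin n → ℕ) i => (m i : ℝ)) Measure.count := by
  have hc : Measure.pi (fun _ : Fin n => (Measure.count : Measure ℕ)) = Measure.count := by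
    refine Measure.ext_of_singleton fun m => ?_
    simp
  have : SigmaFinite (Measure.map (fun m : ℕ => (m : ℝ)) Measure.count) :=
    inferInstanceAs (SigmaFinite natLattice)
  rw [← hc, Measure.pi_map_pi fun _ => measurable_natCast_real.aemeasurable]
  rfl

theorem tsum_eq_kindIntegral (h0 : ∀ i, lam i ≠ 0) (hQ : ∀ i, Continuous (Q i k))
    (hg : ContDiff ℝ (n * k : ℕ) g) (hgs : HasCompactSupport g) :
    ∑' m : Fin n → ℕ, (∏ i, if m i = 0 then q i else 1) * (∏ i, lam i ^ m i) *
      g (fun i => (m i : ℝ)) = kindIntegral q lam Q k g (fun _ => none) 0 := by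
  have hcont := continuous_kindIntegrand (q := q) (τ := fun _ => none) h0 hQ hg
    fun _ => Nat.zero_le k
  have hcs := hasCompactSupport_kindIntegrand (q := q) (lam := lam) (Q := Q) (k := k) hgs
    (fun _ => none)
  have hm : Measurable fun (m : Fin n → ℕ) i => (m i : ℝ) :=
    measurable_pi_lambda _ fun i => measurable_natCast_real.comp (measurable_pi_apply i)
  have hint := hcont.integrable_of_hasCompactSupport hcs (μ := Measure.pi fun _ => natLattice)
  rw [pi_natLattice, integrable_map_measure hcont.aestronglyMeasurable hm.aemeasurable] at hint
  change _ = ∫ t, kindIntegrand q lam Q k g (fun _ => none) (t - 0)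
    ∂Measure.pi fun _ => natLattice
  simp only [sub_zero]
  rw [pi_natLattice, integral_map hm.aemeasurable hcont.aestronglyMeasurable,
    integral_countable (f := fun m : Fin n → ℕ => kindIntegrand q lam Q k g (fun _ => none)
      fun i => (m i : ℝ)) hint]
  refine tsum_congr fun m => ?_
  have hord : mixedPartial (fun _ : Fin n => coordOrder k none) g = g := mixedPartial_zero g
  simp only [kindIntegrand, hord, coordWeight_none_natCast, Finset.prod_mul_distrib]
  simp [measureReal_def]

theorem sum_piFinset_insert {C : Type*} [Inhabited C] (S : Finset C) (T : Finset (Fin n))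
    {i : Fin n} (hi : i ∉ T) (F : (Fin n → C) → ℂ) :
    ∑ σ ∈ Fintype.piFinset (fun l => if l ∈ insert i T then S else {default}), F σ =
      ∑ σ ∈ Fintype.piFinset (fun l => if l ∈ T then S else {default}),
        ∑ c ∈ S, F (Function.update σ i c) := by
  rw [← Finset.sum_product']
  symm
  refine Finset.sum_bij' (fun p _ => Function.update p.1 i p.2)
    (fun σ _ => (Function.update σ i default, σ i)) ?_ ?_ ?_ ?_ fun _ _ => rfl
  · rintro ⟨σ, c⟩ h
    simp only [Finset.mem_product, Fintype.mem_piFinset] at h ⊢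
    intro l
    rcases eq_or_ne l i with rfl | hl
    · simpa using h.2
    · simpa [hl] using h.1 l
  · intro σ h
    simp only [Finset.mem_product, Fintype.mem_piFinset] at h ⊢
    refine ⟨fun l => ?_, by simpa using h i⟩
    rcases eq_or_ne l i with rfl | hl
    · simp [hi]
    · simpa [hl] using h l
  · rintro ⟨σ, c⟩ h
    have h1 : σ i = default := by
      simpa [hi] using Fintype.mem_piFinset.1 (Finset.mem_product.1 h).1 i
    simp [← h1]
  · intro σ h
    simp

/-- Expanding all coordinates, one at a time. -/
theorem eq_sum_piFinset {C : Type*} [Inhabited C] (S : Finset C) (coef : Fin n → C → ℂ)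
    (E : (Fin n → Option C) → ℂ)
    (hE : ∀ τ i, (∀ l, ∀ c, τ l = some c → c ∈ S) → τ i = none →
      E τ = ∑ c ∈ S, coef i c * E (Function.update τ i (some c))) :
    E (fun _ => none) = ∑ σ ∈ Fintype.piFinset (fun _ => S),
      (∏ i, coef i (σ i)) * E (fun i => some (σ i)) := by
  have key : ∀ T : Finset (Fin n), E (fun _ => none) =
      ∑ σ ∈ Fintype.piFinset (fun l => if l ∈ T then S else {default}),
        (∏ i ∈ T, coef i (σ i)) * E (fun i => if i ∈ T then some (σ i) else none) := by
    intro T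
    induction T using Finset.induction_on with
    | empty => simp [Fintype.piFinset_singleton]
    | insert i T hi ih =>
      rw [ih, sum_piFinset_insert S T hi]
      refine Finset.sum_congr rfl fun σ hσ => ?_
      rw [hE _ i _ (by simp [hi]), Finset.mul_sum]
      · refine Finset.sum_congr rfl fun c _ => ?_
        have hprod : ∏ l ∈ T, coef l (Function.update σ i c l) = ∏ l ∈ T, coef l (σ l) :=
          Finset.prod_congr rfl fun l hl => by
            rw [Function.update_of_ne (ne_of_mem_of_not_mem hl hi)]
        rw [Finset.prod_insert hi, Function.update_self, hprod]
        have : (fun l => if l ∈ insert i T then some (Function.update σ i c l) else none) =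
            Function.update (fun l => if l ∈ T then some (σ l) else none) i (some c) := by
          funext l
          rcases eq_or_ne l i with rfl | hl
          · simp
          · simp [hl]
        rw [this]
        ring
      · intro l c hc
        have := Fintype.mem_piFinset.1 hσ l
        by_cases hl : l ∈ T
        · simp only [hl, if_true, Option.some.injEq] at this hc
          exact hc ▸ this
        · simp [hl] at hc
  simpa using key Finset.univ

theorem sum_piFinset_bool (K : ℕ) (F : (Fin n → Bool × ℕ) → ℂ) :
    ∑ σ ∈ Fintype.piFinset (fun _ => Finset.univ ×ˢ Finset.range K), F σ =
      ∑ I : Finset (Fin n), ∑ j ∈ Fintype.piFinset (fun _ => Finset.range K),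
        F (fun i => (decide (i ∈ I), j i)) := by
  rw [← Finset.sum_product']
  symm
  refine Finset.sum_bij' (fun p _ i => (decide (i ∈ p.1), p.2 i))
    (fun σ _ => (Finset.univ.filter fun i => (σ i).1 = true, fun i => (σ i).2))
    ?_ ?_ ?_ ?_ fun _ _ => rfl
  · intro p hp
    simpa [em] using hp
  · intro σ hσ
    simpa using hσ
  · intro p hp
    simp
  · intro σ hσ
    simp

/-- The kinds of the functional which is a derivative of order `j i` in each coordinate in `I`. -/
def orthantKind (I : Finset (Fin n)) (j : Fin n → ℕ) (i : Fin n) : CoordKind :=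
  some (decide (i ∈ I), j i)

theorem kindIntegral_none_eq_sum (h0 : ∀ i, lam i ≠ 0) (hk : 1 < k)
    (hQ : ∀ i, IsQFamily (lam i) (Q i)) (hQc : ∀ i, Continuous (Q i k))
    (hg : ContDiff ℝ (n * k : ℕ) g) (hgs : HasCompactSupport g) :
    kindIntegral q lam Q k g (fun _ => none) 0 =
      ∑ I : Finset (Fin n), ∑ j ∈ Fintype.piFinset (fun _ => Finset.range (k + 1)),
        (∏ i, coordCoeff (q i) (lam i) (Q i) k (decide (i ∈ I), j i)) *
          kindIntegral q lam Q k g (orthantKind I j) 0 := by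
  rw [eq_sum_piFinset (Finset.univ ×ˢ Finset.range (k + 1))
    (fun i => coordCoeff (q i) (lam i) (Q i) k) (fun τ => kindIntegral q lam Q k g τ 0)
    fun τ i hτ hi => kindIntegral_eq_sum h0 hk hQ hQc hg hgs (fun l => ?_) hi,
    sum_piFinset_bool]
  · rfl
  · rcases h : τ l with _ | c
    · exact Nat.zero_le k
    · exact coordOrder_le_of_mem (hτ l c h)

theorem coordOrder_orthantKind_le {I : Finset (Fin n)} {j : Fin n → ℕ} (hj : ∀ i, j i ≤ k + 1)
    (i : Fin n) : coordOrder k (orthantKind I j i) ≤ k := by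
  by_cases hi : i ∈ I
  · have := hj i
    simp only [orthantKind, hi, decide_true, coordOrder]
    omega
  · simp [orthantKind, hi, coordOrder]

theorem orthantKind_update (I : Finset (Fin n)) (j : Fin n → ℕ) (i : Fin n) (m : ℕ) :
    orthantKind I (Function.update j i m) =
      Function.update (orthantKind I j) i (some (decide (i ∈ I), m)) := by
  funext l
  rcases eq_or_ne l i with rfl | hl
  · simp [orthantKind]
  · simp [orthantKind, hl]

theorem hasDerivAt_kindIntegral (h0 : ∀ i, lam i ≠ 0) (hQ : ∀ i, Continuous (Q i k))
    (hg : ContDiff ℝ (n * k : ℕ) g) (hgs : HasCompactSupport g) {I : Finset (Fin n)}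
    {j : Fin n → ℕ} (hj : ∀ i, j i ≤ k) (hI : ∀ i ∉ I, j i = 0) (i : Fin n) (h : Fin n → ℝ)
    (x : ℝ) :
    HasDerivAt (fun x => kindIntegral q lam Q k g (orthantKind I j) (Function.update h i x))
      (kindIntegral q lam Q k g (orthantKind I (Function.update j i (j i + 1)))
        (Function.update h i x)) x := by
  set j' := Function.update j i (j i + 1) with hj'
  have hj'k : ∀ l, j' l ≤ k + 1 := by
    intro l
    rcases eq_or_ne l i with rfl | hl
    · simpa [hj'] using hj l
    · simpa [hj', hl] using (hj l).trans k.le_succ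
  have hord := coordOrder_orthantKind_le (I := I) fun i => (hj i).trans k.le_succ
  have hord' := coordOrder_orthantKind_le (I := I) hj'k
  have hΦ := continuous_kindIntegrand (q := q) h0 hQ hg hord
  have hΦ' := continuous_kindIntegrand (q := q) h0 hQ hg hord'
  have hc := hasCompactSupport_kindIntegrand (q := q) (lam := lam) (Q := Q) (k := k) hgs
    (orthantKind I j)
  have hc' := hasCompactSupport_kindIntegrand (q := q) (lam := lam) (Q := Q) (k := k) hgs
    (orthantKind I j')
  have hν : (fun l => coordMeasure (orthantKind I j' l)) =
      Function.update (fun l => coordMeasure (orthantKind I j l)) i (Measure.dirac 0) := by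
    rw [hj', orthantKind_update, coordMeasure_update]
    simp [coordMeasure]
  have key : kindIntegral q lam Q k g (orthantKind I j) =
      shiftIntegral (kindIntegrand q lam Q k g (orthantKind I j'))
        (Function.update (fun l => coordMeasure (orthantKind I j l)) i
          (volume.restrict (Set.Ici 0))) := by
    have hself : (fun l => coordMeasure (orthantKind I j l)) =
      Function.update (fun l => coordMeasure (orthantKind I j l)) i
        (coordMeasure (orthantKind I j i)) := (Function.update_eq_self i _).symm
    rcases Nat.eq_zero_or_pos (j i) with hji | hji
    · have hint : kindIntegrand q lam Q k g (orthantKind I j') =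
          kindIntegrand q lam Q k g (orthantKind I j) := by
        funext t
        have hjj : orthantKind I j = orthantKind I (Function.update j i (j i)) := by simp
        have ht : t = Function.update t i (t i) := by simp
        rw [hjj, ht, hj', orthantKind_update, orthantKind_update, kindIntegrand_update,
          kindIntegrand_update, hji]
        by_cases hi : i ∈ I <;> simp [hi, coordWeight, coordOrder]
      rw [hint]
      funext h
      rw [kindIntegral, hself]
      simp [coordMeasure, orthantKind, hji]
    · have hi : i ∈ I := by
        by_contra hi
        exact hji.ne' (hI i hi)
      funext h
      rw [kindIntegral, hself]
      have : coordMeasure (orthantKind I j i) = Measure.dirac 0 := by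
        simp [coordMeasure, orthantKind, hji.ne']
      rw [this, Function.update_idem]
      refine shiftIntegral_dirac_eq_Ici (fun l => coordMeasure (orthantKind I j l)) i hΦ hc hΦ' hc' (fun t x => ?_) h
      have hjj : orthantKind I j = Function.update (orthantKind I j) i (some (true, j i)) := by
        simp [orthantKind, hi]
      obtain ⟨m, hm⟩ : ∃ m, j i = m + 1 := ⟨j i - 1, by omega⟩
      have hd := hasDerivAt_mixedPartial hg
        (a := Function.update (fun l => coordOrder k (orthantKind I j l)) i m) (i := i)
        (fun l => by
          rcases eq_or_ne l i with rfl | hl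
          · have := hj l
            simp only [Function.update_self]
            omega
          · simpa [hl] using hord l) (by have := hj i; simp only [Function.update_self]; omega) t x
      rw [hj', orthantKind_update, kindIntegrand_update]
      conv => enter [1, x]; rw [hjj, kindIntegrand_update]
      have hw : ∀ j x, coordWeight (q i) (lam i) (Q i) k (some (true, j)) x = (-1) ^ (j - 1) :=
        fun _ _ => rfl
      have ho : ∀ j, coordOrder k (some (true, j)) = j - 1 := fun _ => rfl
      simp only [hw, ho, hi, hm, decide_true, add_tsub_cancel_right]
      simp only [Function.update_idem, Function.update_self] at hd
      refine ((hd.const_mul _).const_mul _).congr_deriv ?_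
      rw [pow_succ]
      ring
  rw [key, kindIntegral, hν]
  exact hasDerivAt_shiftIntegral_Ici _ i hΦ' hc' h x

theorem coordPartial_kindIntegral (h0 : ∀ i, lam i ≠ 0) (hQ : ∀ i, Continuous (Q i k))
    (hg : ContDiff ℝ (n * k : ℕ) g) (hgs : HasCompactSupport g) {I : Finset (Fin n)}
    {j : Fin n → ℕ} (hj : ∀ i, j i ≤ k) (hI : ∀ i ∉ I, j i = 0) (i : Fin n) :
    coordPartial i (kindIntegral q lam Q k g (orthantKind I j)) =
      kindIntegral q lam Q k g (orthantKind I (Function.update j i (j i + 1))) := by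
  funext h
  have hd := hasFDerivAt_of_continuous_partial
    (hasDerivAt_kindIntegral (q := q) h0 hQ hg hgs hj hI) (fun i => ?_) h
  · rw [coordPartial, hd.fderiv]
    simp [Pi.single_apply]
  · refine continuous_shiftIntegral _ (continuous_kindIntegrand h0 hQ hg
      (coordOrder_orthantKind_le fun l => ?_)) (hasCompactSupport_kindIntegrand hgs _)
    rcases eq_or_ne l i with rfl | hl
    · simpa using hj l
    · simpa [hl] using (hj l).trans k.le_succ

theorem mixedPartial_kindIntegral (h0 : ∀ i, lam i ≠ 0) (hQ : ∀ i, Continuous (Q i k))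
    (hg : ContDiff ℝ (n * k : ℕ) g) (hgs : HasCompactSupport g) {I : Finset (Fin n)}
    {j : Fin n → ℕ} (hj : ∀ i, j i ≤ k) (hI : ∀ i ∉ I, j i = 0) :
    mixedPartial j (kindIntegral q lam Q k g (orthantKind I fun _ => 0)) =
      kindIntegral q lam Q k g (orthantKind I j) := by
  have hit : ∀ (i : Fin n) (m : ℕ) (b : Fin n → ℕ), m ≤ j i → b i = 0 → (∀ l, b l ≤ j l) →
      (coordPartial i)^[m] (kindIntegral q lam Q k g (orthantKind I b)) =
        kindIntegral q lam Q k g (orthantKind I (Function.update b i m)) := by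
    intro i m b hm hb hbj
    induction m with
    | zero => rw [← hb, Function.update_eq_self, hb, Function.iterate_zero_apply]
    | succ m ih =>
      have hle : ∀ l, Function.update b i m l ≤ j l := fun l => by
        rcases eq_or_ne l i with rfl | hl
        · simpa using (Nat.le_succ m).trans hm
        · simpa [hl] using hbj l
      rw [Function.iterate_succ_apply', ih (by omega), coordPartial_kindIntegral h0 hQ hg hgs
        (fun l => (hle l).trans (hj l)) fun l hl => Nat.le_zero.1 (hI l hl ▸ hle l)]
      simp
  have key : ∀ L : List (Fin n), L.Nodup →
      L.foldr (fun i G => (coordPartial i)^[j i] G)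
          (kindIntegral q lam Q k g (orthantKind I fun _ => 0)) =
        kindIntegral q lam Q k g (orthantKind I fun i => if i ∈ L then j i else 0) := by
    intro L hL
    induction L with
    | nil => simp
    | cons l L ih =>
      rw [List.nodup_cons] at hL
      rw [List.foldr_cons, ih hL.2, hit l (j l) _ le_rfl (by simp [hL.1])
        (fun i => by split_ifs <;> omega)]
      congr 2
      funext i
      rcases eq_or_ne i l with rfl | hi
      · simp
      · simp [hi]
  simpa only [List.mem_finRange, if_true, mixedPartial] using key _ (List.nodup_finRange n)

theorem integral_stdOrthant_eq_kindIntegral (I : Finset (Fin n)) (h : Fin n → ℝ) :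
    ∫ t in stdOrthant n h, (∏ i ∈ Iᶜ, Q i k (t i)) *
        mixedPartial (fun i => if i ∈ I then 0 else k) g t =
      kindIntegral q lam Q k g (orthantKind I fun _ => 0) h := by
  have hint : ∀ t, kindIntegrand q lam Q k g (orthantKind I fun _ => 0) t =
      (∏ i ∈ Iᶜ, Q i k (t i)) * mixedPartial (fun i => if i ∈ I then 0 else k) g t := by
    intro t
    rw [kindIntegrand]
    congr 1
    · rw [← Finset.prod_mul_prod_compl I, Finset.prod_eq_one, one_mul]
      · refine Finset.prod_congr rfl fun i hi => ?_
        rw [Finset.mem_compl] at hi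
        simp [orthantKind, coordWeight, hi]
      · intro i hi
        simp [orthantKind, coordWeight, hi]
    · congr 1
      funext i
      by_cases hi : i ∈ I <;> simp [orthantKind, coordOrder, hi]
  have hpre : (fun t : Fin n → ℝ => t - h) ⁻¹' stdOrthant n h =
      Set.univ.pi fun _ => Set.Ici 0 := by
    ext t
    simp [stdOrthant, Pi.le_def]
  have hmp := (measurePreserving_sub_right volume h).setIntegral_preimage_emb
    (MeasurableEquiv.subRight h).measurableEmbedding
    (kindIntegrand q lam Q k g (orthantKind I fun _ => 0)) (stdOrthant n h)
  rw [hpre, volume_pi, Measure.restrict_pi_pi] at hmp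
  simp only [← hint]
  rw [volume_pi, ← hmp, kindIntegral, shiftIntegral]
  simp [orthantKind, coordMeasure]

end Kinds

theorem coordCoeff_decide (q lam : ℂ) (Q : ℕ → ℝ → ℂ) (k : ℕ) (b : Prop) [Decidable b]
    (j : ℕ) :
    coordCoeff q lam Q k (decide b, j) = (if b then 1 else (-1) ^ (k - 1)) *
      (if b then Ncoeff q lam Q k else fun j => if j = 0 then 1 else 0) j := by
  by_cases hb : b <;> simp [hb, coordCoeff]

theorem sum_orthantKind_eq_opApply {n : ℕ} {q lam : Fin n → ℂ} {Q : Fin n → ℕ → ℝ → ℂ} {k : ℕ}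
    {g : (Fin n → ℝ) → ℂ} (h0 : ∀ i, lam i ≠ 0) (hQ : ∀ i, Continuous (Q i k))
    (hg : ContDiff ℝ (n * k : ℕ) g) (hgs : HasCompactSupport g) (I : Finset (Fin n)) :
    ∑ j ∈ Fintype.piFinset (fun _ => Finset.range (k + 1)),
        (∏ i, coordCoeff (q i) (lam i) (Q i) k (decide (i ∈ I), j i)) *
          kindIntegral q lam Q k g (orthantKind I j) 0 =
      (-1) ^ ((k - 1) * (n - I.card)) *
        opApply
          (fun i => if i ∈ I then Ncoeff (q i) (lam i) (Q i) k
            else fun j => if j = 0 then 1 else 0) k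
          (fun h => ∫ t in stdOrthant n h,
            (∏ i ∈ Iᶜ, Q i k (t i)) *
              mixedPartial (fun i => if i ∈ I then 0 else k) g t) := by
  rw [opApply, Finset.mul_sum]
  refine Finset.sum_congr rfl fun j hj => ?_
  have hsign : ∏ i, (if i ∈ I then (1 : ℂ) else (-1) ^ (k - 1)) =
      (-1) ^ ((k - 1) * (n - I.card)) := by
    rw [← Finset.prod_mul_prod_compl I, Finset.prod_eq_one fun i hi => if_pos hi, one_mul,
      Finset.prod_congr rfl fun i hi => if_neg (Finset.mem_compl.1 hi), Finset.prod_const,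
      Finset.card_compl, Fintype.card_fin, pow_mul]
  simp only [coordCoeff_decide, Finset.prod_mul_distrib, hsign]
  rw [mul_assoc]
  congr 1
  by_cases hI : ∀ i ∉ I, j i = 0
  · have hjk : ∀ i, j i ≤ k := fun i => by
      have := Fintype.mem_piFinset.1 hj i
      rw [Finset.mem_range] at this
      omega
    have hfun : (fun h => ∫ t in stdOrthant n h, (∏ i ∈ Iᶜ, Q i k (t i)) *
        mixedPartial (fun i => if i ∈ I then 0 else k) g t) =
        kindIntegral q lam Q k g (orthantKind I fun _ => 0) :=
      funext fun h => integral_stdOrthant_eq_kindIntegral I h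
    rw [hfun, mixedPartial_kindIntegral h0 hQ hg hgs hjk hI]
  · push Not at hI
    obtain ⟨i, hi, hji⟩ := hI
    rw [Finset.prod_eq_zero (Finset.mem_univ i) (by simp [hi, hji]), zero_mul, zero_mul]

/-- **Twisted weighted Euler–Maclaurin with remainder for the standard orthant.**
For roots of unity `λ₁,…,λₙ` (possibly `1`), `q₁,…,qₙ ∈ ℂ`, an integer `k > 1` and a
compactly supported `g : ℝⁿ → ℂ` of class `C^{nk}`,
`∑_{m ∈ ℤ_{≥0}ⁿ} (∏_{i : mᵢ=0} qᵢ)(∏ᵢ λᵢ^{mᵢ}) g(m)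
  = [∏ᵢ N_{qᵢ}^{k,λᵢ}(∂/∂hᵢ)] ∫_{O(h)} g |_{h=0} + R^{st}_{q,k}(λ₁,…,λₙ; g)`. -/
theorem twisted_weighted_euler_maclaurin_orthant
    (n : ℕ) (hn : 1 ≤ n) (lam q : Fin n → ℂ)
    (hroot : ∀ i, ∃ N : ℕ, 0 < N ∧ lam i ^ N = 1)
    (k : ℕ) (hk : 1 < k)
    (Q : Fin n → ℕ → ℝ → ℂ) (hQ : ∀ i, IsQFamily (lam i) (Q i))
    (g : (Fin n → ℝ) → ℂ) (hg : ContDiff ℝ (n * k : ℕ) g)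
    (hgsupp : HasCompactSupport g) :
    (∑' m : Fin n → ℕ,
        (∏ i, if m i = 0 then q i else 1) * (∏ i, lam i ^ m i) *
          g (fun i => (m i : ℝ))) =
      opApply (fun i => Ncoeff (q i) (lam i) (Q i) k) k
        (fun h => ∫ t in stdOrthant n h, g t)
      + orthantRemainder q lam Q k g := by
  have h0 : ∀ i, lam i ≠ 0 := fun i hi => by
    obtain ⟨N, hN, h⟩ := hroot i
    rw [hi, zero_pow hN.ne'] at h
    exact zero_ne_one h
  have hQc : ∀ i, Continuous (Q i k) := fun i => by
    obtain ⟨c, a, P, -⟩ := (hQ i).exists_isSawtoothFamily (h0 i) (q i) hk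
    exact P.continuous k hk
  rw [tsum_eq_kindIntegral h0 hQc hg hgsupp, kindIntegral_none_eq_sum h0 hk hQ hQc hg hgsupp]
  simp only [sum_orthantKind_eq_opApply h0 hQc hg hgsupp]
  rw [← Finset.add_sum_erase _ _ (Finset.mem_univ (Finset.univ : Finset (Fin n))),
    orthantRemainder, Finset.powerset_univ]
  congr 1
  simp only [Finset.mem_univ, if_true, Finset.compl_univ, Finset.prod_empty, one_mul,
    Finset.card_univ, Fintype.card_fin, tsub_self, mul_zero, pow_zero, mixedPartial_zero]
end
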